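/- arXiv:2510.12221 — 5 statements merged into one kernel-verified Lean document; each statement's English description precedes it below -/
import Mathlib

section
/- Let d ≥ 1 be an integer and let α, β ∈ ℝ satisfy α + β > d, α < d and β < d. Then there exists a constant C > 0, depending only on d, α, β, such that for every n ∈ ℤ^d the series ∑_{n₁ ∈ ℤ^d} ⟨n₁⟩^{−α} · ⟨n − n₁⟩^{−β} converges and is bounded by C · ⟨n⟩^{d − α − β}. -/
/-- The Japanese bracket `⟨x⟩ = √(1 + |x|²)` for lattice points `x ∈ ℤ^d`. -/
noncomputable def jbD (d : ℕ) (x : Fin d → ℤ) : ℝ :=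
  Real.sqrt (1 + ∑ i, ((x i : ℝ)) ^ 2)

theorem jbD_sq (d : ℕ) (x : Fin d → ℤ) : jbD d x ^ 2 = 1 + ∑ i, ((x i : ℝ)) ^ 2 :=
  Real.sq_sqrt (by positivity)

theorem one_le_jbD (d : ℕ) (x : Fin d → ℤ) : 1 ≤ jbD d x :=
  Real.one_le_sqrt.2 (le_add_of_nonneg_right (by positivity))

theorem jbD_pos (d : ℕ) (x : Fin d → ℤ) : 0 < jbD d x :=
  one_pos.trans_le (one_le_jbD d x)

theorem abs_coord_le_jbD (d : ℕ) (x : Fin d → ℤ) (i : Fin d) : |(x i : ℝ)| ≤ jbD d x := by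
  refine Real.abs_le_sqrt ?_
  have := Finset.single_le_sum (f := fun i => ((x i : ℝ)) ^ 2) (fun i _ => sq_nonneg _)
    (Finset.mem_univ i)
  linarith

theorem jbD_add_le (d : ℕ) (x y : Fin d → ℤ) : jbD d (x + y) ≤ jbD d x + jbD d y := by
  have hx := jbD_pos d x
  have hy := jbD_pos d y
  have hsum : ∑ i, (x i : ℝ) * y i ≤ jbD d x * jbD d y := by
    refine (Real.sum_mul_le_sqrt_mul_sqrt _ _ _).trans ?_
    unfold jbD
    gcongr <;> simp
  refine Real.sqrt_le_iff.2 ⟨by positivity, ?_⟩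
  have expand : ∑ i, (((x + y) i : ℤ) : ℝ) ^ 2 =
      ∑ i, (x i : ℝ) ^ 2 + 2 * ∑ i, (x i : ℝ) * y i + ∑ i, (y i : ℝ) ^ 2 := by
    rw [Finset.mul_sum, ← Finset.sum_add_distrib, ← Finset.sum_add_distrib]
    refine Finset.sum_congr rfl fun i _ => ?_
    simp only [Pi.add_apply, Int.cast_add]
    ring
  nlinarith [jbD_sq d x, jbD_sq d y]

/-- At most `(3 r) ^ d` lattice points have Japanese bracket at most `r`. -/
theorem tsum_indicator_jbD_le (d : ℕ) (r : ℝ) :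
    ∑' x : Fin d → ℤ, (if jbD d x ≤ r then 1 else 0 : ENNReal) ≤
      ENNReal.ofReal ((3 * r) ^ (d : ℝ)) := by
  rcases lt_or_ge r 1 with h | h
  · have : ∀ x : Fin d → ℤ, ¬ jbD d x ≤ r := fun x hx => by linarith [one_le_jbD d x]
    simp [this]
  let s : Finset (Fin d → ℤ) := Fintype.piFinset fun _ => Finset.Icc (-⌊r⌋) ⌊r⌋
  have hs : ∀ x, jbD d x ≤ r → x ∈ s := by
    intro x hx
    refine Fintype.mem_piFinset.2 fun i => Finset.mem_Icc.2 ?_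
    have := abs_le.1 ((abs_coord_le_jbD d x i).trans hx)
    refine ⟨neg_le.1 (Int.le_floor.2 ?_), Int.le_floor.2 this.2⟩
    push_cast
    linarith
  have hcard : (s.card : ℝ) ≤ (3 * r) ^ (d : ℝ) := by
    have hfl : 1 ≤ ⌊r⌋ := Int.le_floor.2 (by simpa using h)
    have : (((⌊r⌋ + 1 - -⌊r⌋).toNat : ℤ) : ℝ) ≤ 3 * r := by
      rw [Int.toNat_of_nonneg (by omega)]
      push_cast
      linarith [Int.floor_le r]
    rw [Real.rpow_natCast]
    simp only [s, Fintype.card_piFinset, Int.card_Icc, Finset.prod_const, Finset.card_univ,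
      Fintype.card_fin, Nat.cast_pow]
    gcongr
    exact_mod_cast this
  rw [tsum_eq_sum (s := s) fun x hx => if_neg fun h => hx (hs x h)]
  calc ∑ x ∈ s, (if jbD d x ≤ r then 1 else 0 : ENNReal)
      ≤ ∑ x ∈ s, 1 := Finset.sum_le_sum fun x _ => by split_ifs <;> simp
    _ = ENNReal.ofReal s.card := by simp
    _ ≤ _ := ENNReal.ofReal_le_ofReal hcard

/-- A sum over the lattice is controlled by covering the support with balls of radius `ρ k` on
which the summand is at most `b k`. -/
theorem tsum_ofReal_le_of_shells (d : ℕ) {g : (Fin d → ℤ) → ℝ} {b ρ : ℕ → ℝ} {S : ℝ}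
    (hb : ∀ k, 0 ≤ b k) (hρ : ∀ k, 0 < ρ k)
    (hg : ∀ x, g x ≤ 0 ∨ ∃ k, jbD d x ≤ ρ k ∧ g x ≤ b k)
    (hS : HasSum (fun k => b k * (3 * ρ k) ^ (d : ℝ)) S) :
    ∑' x, ENNReal.ofReal (g x) ≤ ENNReal.ofReal S := by
  have hpt : ∀ x, ENNReal.ofReal (g x) ≤
      ∑' k, ENNReal.ofReal (b k) * (if jbD d x ≤ ρ k then 1 else 0) := by
    intro x
    rcases hg x with h | ⟨k, hk, hgk⟩
    · simp [ENNReal.ofReal_of_nonpos h]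
    · refine le_trans ?_ (ENNReal.le_tsum k)
      simpa [hk] using ENNReal.ofReal_le_ofReal hgk
  calc ∑' x, ENNReal.ofReal (g x)
      ≤ ∑' x, ∑' k, ENNReal.ofReal (b k) * (if jbD d x ≤ ρ k then 1 else 0) :=
        ENNReal.tsum_le_tsum hpt
    _ = ∑' k, ENNReal.ofReal (b k) * ∑' x, (if jbD d x ≤ ρ k then 1 else 0) := by
        rw [ENNReal.tsum_comm]
        simp_rw [ENNReal.tsum_mul_left]
    _ ≤ ∑' k, ENNReal.ofReal (b k * (3 * ρ k) ^ (d : ℝ)) := by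
        refine ENNReal.tsum_le_tsum fun k => ?_
        rw [ENNReal.ofReal_mul (hb k)]
        gcongr
        exact tsum_indicator_jbD_le d (ρ k)
    _ = ENNReal.ofReal S := by
        rw [← hS.tsum_eq, ENNReal.ofReal_tsum_of_nonneg _ hS.summable]
        intro k
        have := hb k
        have := hρ k
        positivity

theorem exists_tsum_jbD_rpow_ball_le (d : ℕ) {a : ℝ} (ha : 0 ≤ a) (had : a < d) :
    ∃ C : ℝ, 0 < C ∧ ∀ R : ℝ, 0 < R →
      ∑' x : Fin d → ℤ, ENNReal.ofReal (if jbD d x ≤ R then jbD d x ^ (-a) else 0) ≤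
        ENNReal.ofReal (C * R ^ ((d : ℝ) - a)) := by
  set q : ℝ := (2⁻¹ : ℝ) ^ ((d : ℝ) - a) with hq
  have hq1 : q < 1 := Real.rpow_lt_one (by norm_num) (by norm_num) (by linarith)
  have hq0 : 0 < q := by positivity
  refine ⟨2 ^ a * 3 ^ (d : ℝ) * (1 - q)⁻¹, ?_, fun R hR => ?_⟩
  · have : 0 < 1 - q := by linarith
    positivity
  refine tsum_ofReal_le_of_shells d (b := fun k => (R * 2⁻¹ ^ (k + 1)) ^ (-a))
    (ρ := fun k => R * 2⁻¹ ^ k) (fun k => by positivity) (fun k => by positivity) ?_ ?_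
  · intro x
    split_ifs with hx
    · right
      obtain ⟨k, hk1, hk2⟩ := exists_nat_pow_near_of_lt_one (x := jbD d x / R) (y := 2⁻¹)
        (div_pos (jbD_pos d x) hR) ((div_le_one hR).2 hx) (by norm_num) (by norm_num)
      rw [lt_div_iff₀' hR] at hk1
      exact ⟨k, (div_le_iff₀' hR).1 hk2,
        Real.rpow_le_rpow_of_nonpos (by positivity) hk1.le (by linarith)⟩
    · exact Or.inl le_rfl
  · convert (hasSum_geometric_of_lt_one hq0.le hq1).mul_left
      (2 ^ a * 3 ^ (d : ℝ) * R ^ ((d : ℝ) - a)) using 1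
    · rfl
    · funext k
      have h2 : (0 : ℝ) < 2⁻¹ ^ k := by positivity
      have e2 : q ^ k = (2⁻¹ ^ k : ℝ) ^ ((d : ℝ) - a) := by
        rw [hq, ← Real.rpow_mul_natCast (by norm_num), mul_comm, Real.rpow_natCast_mul (by norm_num)]
      have e3 : (2⁻¹ : ℝ) ^ (-a) = 2 ^ a := by
        rw [Real.inv_rpow (by norm_num), Real.rpow_neg (by norm_num), inv_inv]
      rw [e2, pow_succ, Real.mul_rpow hR.le (by positivity), Real.mul_rpow h2.le (by norm_num),
        Real.mul_rpow (by norm_num) (by positivity), Real.mul_rpow hR.le h2.le, e3,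
        sub_eq_add_neg, Real.rpow_add hR, Real.rpow_add h2]
      ring
    · ring

theorem exists_tsum_jbD_rpow_tail_le (d : ℕ) {s : ℝ} (hs : (d : ℝ) < s) :
    ∃ C : ℝ, 0 < C ∧ ∀ R : ℝ, 0 < R →
      ∑' x : Fin d → ℤ, ENNReal.ofReal (if R ≤ jbD d x then jbD d x ^ (-s) else 0) ≤
        ENNReal.ofReal (C * R ^ ((d : ℝ) - s)) := by
  have hs0 : 0 < s := (Nat.cast_nonneg d).trans_lt hs
  set q : ℝ := (2 : ℝ) ^ ((d : ℝ) - s) with hq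
  have hq1 : q < 1 := Real.rpow_lt_one_of_one_lt_of_neg (by norm_num) (by linarith)
  have hq0 : 0 < q := by positivity
  refine ⟨2 ^ (d : ℝ) * 3 ^ (d : ℝ) * (1 - q)⁻¹, ?_, fun R hR => ?_⟩
  · have : 0 < 1 - q := by linarith
    positivity
  refine tsum_ofReal_le_of_shells d (b := fun k => (R * 2 ^ k) ^ (-s))
    (ρ := fun k => R * 2 ^ (k + 1)) (fun k => by positivity) (fun k => by positivity) ?_ ?_
  · intro x
    split_ifs with hx
    · right
      obtain ⟨k, hk1, hk2⟩ := exists_nat_pow_near (x := jbD d x / R) (y := 2)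
        ((one_le_div hR).2 hx) (by norm_num)
      rw [le_div_iff₀' hR] at hk1
      exact ⟨k, ((div_lt_iff₀' hR).1 hk2).le,
        Real.rpow_le_rpow_of_nonpos (by positivity) hk1 (by linarith)⟩
    · exact Or.inl le_rfl
  · convert (hasSum_geometric_of_lt_one hq0.le hq1).mul_left
      (2 ^ (d : ℝ) * 3 ^ (d : ℝ) * R ^ ((d : ℝ) - s)) using 1
    · rfl
    · funext k
      have h2 : (0 : ℝ) < 2 ^ k := by positivity
      have e2 : q ^ k = (2 ^ k : ℝ) ^ ((d : ℝ) - s) := by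
        rw [hq, ← Real.rpow_mul_natCast (by norm_num), mul_comm, Real.rpow_natCast_mul (by norm_num)]
      rw [e2, pow_succ, Real.mul_rpow hR.le (by positivity),
        Real.mul_rpow (by norm_num) (by positivity), Real.mul_rpow hR.le (by positivity),
        Real.mul_rpow h2.le (by norm_num),
        sub_eq_add_neg, Real.rpow_add hR, Real.rpow_add h2]
      ring
    · ring

theorem rpow_neg_mul_rpow_neg_le_add {u v α β : ℝ} (hu : 0 < u) (hv : 0 < v) (hα : 0 ≤ α)
    (hβ : 0 ≤ β) : u ^ (-α) * v ^ (-β) ≤ u ^ (-(α + β)) + v ^ (-(α + β)) := by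
  have hu' : 0 ≤ u ^ (-(α + β)) := by positivity
  have hv' : 0 ≤ v ^ (-(α + β)) := by positivity
  rcases le_total u v with h | h
  · have : u ^ (-α) * v ^ (-β) ≤ u ^ (-α) * u ^ (-β) := by
      gcongr ?_ * ?_
      exact Real.rpow_le_rpow_of_nonpos hu h (by linarith)
    rw [← Real.rpow_add hu, ← neg_add] at this
    linarith
  · have : u ^ (-α) * v ^ (-β) ≤ v ^ (-α) * v ^ (-β) := by
      gcongr ?_ * ?_
      exact Real.rpow_le_rpow_of_nonpos hv h (by linarith)
    rw [← Real.rpow_add hv, ← neg_add] at this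
    linarith

/-- If `u + v ≥ 2 R`, the product `u ^ (-α) * v ^ (-β)` splits into contributions from
`u ≤ R`, `v ≤ R`, and the region where both are at least `R`. -/
theorem rpow_neg_mul_rpow_neg_le_split {u v R α β : ℝ} (hu : 0 < u) (hv : 0 < v) (hR : 0 < R)
    (hα : 0 ≤ α) (hβ : 0 ≤ β) (huv : 2 * R ≤ u + v) :
    u ^ (-α) * v ^ (-β) ≤
      R ^ (-β) * (if u ≤ R then u ^ (-α) else 0) + R ^ (-α) * (if v ≤ R then v ^ (-β) else 0) +
      (if R ≤ u then u ^ (-(α + β)) else 0) + (if R ≤ v then v ^ (-(α + β)) else 0) := by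
  have h1 : 0 ≤ R ^ (-β) * (if u ≤ R then u ^ (-α) else 0) := by split_ifs <;> positivity
  have h2 : 0 ≤ R ^ (-α) * (if v ≤ R then v ^ (-β) else 0) := by split_ifs <;> positivity
  have h3 : 0 ≤ if R ≤ u then u ^ (-(α + β)) else 0 := by split_ifs <;> positivity
  have h4 : 0 ≤ if R ≤ v then v ^ (-(α + β)) else 0 := by split_ifs <;> positivity
  rcases le_total u R with hu' | hu'
  · have : u ^ (-α) * v ^ (-β) ≤ R ^ (-β) * (if u ≤ R then u ^ (-α) else 0) := by
      rw [if_pos hu', mul_comm]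
      gcongr ?_ * ?_
      exact Real.rpow_le_rpow_of_nonpos hR (by linarith) (by linarith)
    linarith
  rcases le_total v R with hv' | hv'
  · have : u ^ (-α) * v ^ (-β) ≤ R ^ (-α) * (if v ≤ R then v ^ (-β) else 0) := by
      rw [if_pos hv']
      gcongr ?_ * ?_
      exact Real.rpow_le_rpow_of_nonpos hR hu' (by linarith)
    linarith
  · have := rpow_neg_mul_rpow_neg_le_add hu hv hα hβ
    rw [if_pos hu', if_pos hv'] at *
    linarith

theorem summable_and_tsum_le_of_tsum_ofReal_le {ι : Type*} {f : ι → ℝ} {B : ℝ}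
    (hf : ∀ i, 0 ≤ f i) (hB : 0 ≤ B)
    (h : ∑' i, ENNReal.ofReal (f i) ≤ ENNReal.ofReal B) : Summable f ∧ ∑' i, f i ≤ B := by
  have hfin : ∀ s : Finset ι, ∑ i ∈ s, f i ≤ B := fun s => by
    rw [← ENNReal.ofReal_le_ofReal_iff hB, ENNReal.ofReal_sum_of_nonneg fun i _ => hf i]
    exact (ENNReal.sum_le_tsum s).trans h
  exact ⟨summable_of_sum_le hf hfin, Real.tsum_le_of_sum_le hf hfin⟩

/-- discrete convolution sum: for `d ≥ 1` and `α + β > d`, `α < d`, `β < d`,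
there is `C > 0` depending only on `d, α, β` such that for every `n ∈ ℤ^d`,
`∑_{n₁} ⟨n₁⟩^{-α} ⟨n - n₁⟩^{-β}` converges and is `≤ C ⟨n⟩^{d - α - β}`. -/
theorem discrete_convolution_sum (d : ℕ) (hd : 1 ≤ d) (α β : ℝ)
    (hαβ : (d : ℝ) < α + β) (hα : α < (d : ℝ)) (hβ : β < (d : ℝ)) :
    ∃ C : ℝ, 0 < C ∧ ∀ n : Fin d → ℤ,
      Summable (fun n₁ : Fin d → ℤ => jbD d n₁ ^ (-α) * jbD d (n - n₁) ^ (-β)) ∧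
      (∑' n₁ : Fin d → ℤ, jbD d n₁ ^ (-α) * jbD d (n - n₁) ^ (-β)) ≤
        C * jbD d n ^ ((d : ℝ) - α - β) := by
  have hα0 : 0 < α := by linarith
  have hβ0 : 0 < β := by linarith
  obtain ⟨A, hA, hball_α⟩ := exists_tsum_jbD_rpow_ball_le d hα0.le hα
  obtain ⟨B, hB, hball_β⟩ := exists_tsum_jbD_rpow_ball_le d hβ0.le hβ
  obtain ⟨T, hT, htail⟩ := exists_tsum_jbD_rpow_tail_le d hαβ
  refine ⟨(A + B + T + T) * 2⁻¹ ^ ((d : ℝ) - α - β), by positivity, fun n => ?_⟩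
  have hn := jbD_pos d n
  refine summable_and_tsum_le_of_tsum_ofReal_le (fun m => ?_) (by positivity) ?_
  · have := jbD_pos d m
    have := jbD_pos d (n - m)
    positivity
  obtain ⟨R, hR⟩ : ∃ R, R = 2⁻¹ * jbD d n := ⟨_, rfl⟩
  have hR0 : 0 < R := by rw [hR]; positivity
  let ball (a : ℝ) (x : Fin d → ℤ) : ℝ := if jbD d x ≤ R then jbD d x ^ (-a) else 0
  let tail (x : Fin d → ℤ) : ℝ := if R ≤ jbD d x then jbD d x ^ (-(α + β)) else 0
  have reflect (g : (Fin d → ℤ) → ENNReal) : ∑' m, g (n - m) = ∑' m, g m :=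
    (Equiv.subLeft n).tsum_eq g
  have hpt (m : Fin d → ℤ) :
      ENNReal.ofReal (jbD d m ^ (-α) * jbD d (n - m) ^ (-β)) ≤
        ENNReal.ofReal (R ^ (-β)) * ENNReal.ofReal (ball α m) +
        ENNReal.ofReal (R ^ (-α)) * ENNReal.ofReal (ball β (n - m)) +
        ENNReal.ofReal (tail m) + ENNReal.ofReal (tail (n - m)) := by
    have htri : 2 * R ≤ jbD d m + jbD d (n - m) := by
      have := jbD_add_le d m (n - m)
      rw [add_sub_cancel] at this
      linarith
    rw [← ENNReal.ofReal_mul (by positivity), ← ENNReal.ofReal_mul (by positivity)]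
    exact (ENNReal.ofReal_le_ofReal (rpow_neg_mul_rpow_neg_le_split (jbD_pos d m)
      (jbD_pos d (n - m)) hR0 hα0.le hβ0.le htri)).trans <| ENNReal.ofReal_add_le.trans <|
        add_le_add_left (ENNReal.ofReal_add_le.trans <|
          add_le_add_left ENNReal.ofReal_add_le _) _
  calc ∑' m, ENNReal.ofReal (jbD d m ^ (-α) * jbD d (n - m) ^ (-β))
      ≤ ENNReal.ofReal (R ^ (-β)) * ∑' m, ENNReal.ofReal (ball α m) +
        ENNReal.ofReal (R ^ (-α)) * ∑' m, ENNReal.ofReal (ball β m) +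
        ∑' m, ENNReal.ofReal (tail m) + ∑' m, ENNReal.ofReal (tail m) := by
        refine (ENNReal.tsum_le_tsum hpt).trans_eq ?_
        rw [ENNReal.tsum_add, ENNReal.tsum_add, ENNReal.tsum_add, ENNReal.tsum_mul_left,
          ENNReal.tsum_mul_left, reflect fun m => ENNReal.ofReal (ball β m),
          reflect fun m => ENNReal.ofReal (tail m)]
    _ ≤ ENNReal.ofReal (R ^ (-β)) * ENNReal.ofReal (A * R ^ ((d : ℝ) - α)) +
        ENNReal.ofReal (R ^ (-α)) * ENNReal.ofReal (B * R ^ ((d : ℝ) - β)) +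
        ENNReal.ofReal (T * R ^ ((d : ℝ) - (α + β))) +
        ENNReal.ofReal (T * R ^ ((d : ℝ) - (α + β))) := by
        gcongr
        exacts [hball_α R hR0, hball_β R hR0, htail R hR0, htail R hR0]
    _ = ENNReal.ofReal ((A + B + T + T) * 2⁻¹ ^ ((d : ℝ) - α - β) *
          jbD d n ^ ((d : ℝ) - α - β)) := by
        rw [← ENNReal.ofReal_mul (by positivity), ← ENNReal.ofReal_mul (by positivity),
          ← ENNReal.ofReal_add (by positivity) (by positivity),
          ← ENNReal.ofReal_add (by positivity) (by positivity),
          ← ENNReal.ofReal_add (by positivity) (by positivity),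
          mul_assoc _ (2⁻¹ ^ _), ← Real.mul_rpow (by norm_num) hn.le, ← hR]
        have e1 : R ^ (-β) * R ^ ((d : ℝ) - α) = R ^ ((d : ℝ) - α - β) := by
          rw [← Real.rpow_add hR0]; ring_nf
        have e2 : R ^ (-α) * R ^ ((d : ℝ) - β) = R ^ ((d : ℝ) - α - β) := by
          rw [← Real.rpow_add hR0]; ring_nf
        rw [← sub_sub, mul_left_comm, mul_left_comm _ B, e1, e2]
        ring_nf
end

section
/- There exists a universal constant C > 0 with the following property: for all dyadic numbers A, N, every a ∈ ℤ² with |a| ∼ A, and every m ∈ ℤ, the cardinality of the set { n ∈ ℤ² : |n| ∼ N and |⟨a + n⟩ − ⟨n⟩ − m| ≤ 1 } is at most C · N² / min(A, N)^{1/2}. -/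
/-- The Euclidean norm of a lattice point `x ∈ ℤ²`. -/
noncomputable def znorm (x : Fin 2 → ℤ) : ℝ :=
  Real.sqrt ((x 0 : ℝ) ^ 2 + (x 1 : ℝ) ^ 2)

/-- The Japanese bracket `⟨x⟩ = √(1 + |x|²)` for lattice points `x ∈ ℤ²`. -/
noncomputable def jb (x : Fin 2 → ℤ) : ℝ :=
  Real.sqrt (1 + (x 0 : ℝ) ^ 2 + (x 1 : ℝ) ^ 2)

/-- `|x| ∼ N`, i.e. `N/2 ≤ |x| ≤ 2N`. -/
def ann (N : ℝ) (x : Fin 2 → ℤ) : Prop :=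
  N / 2 ≤ znorm x ∧ znorm x ≤ 2 * N

/-- The counting set of the hyperbolic basic counting estimate. -/
def hypSet (N : ℝ) (a : Fin 2 → ℤ) (m : ℤ) : Set (Fin 2 → ℤ) :=
  {n | ann N n ∧ |jb (a + n) - jb n - (m : ℝ)| ≤ 1}

/-- If `g` varies by at most `D` on `s`, and every subset of `s` on which `g` varies by less than `1`
has at most `K` elements, then `s` has at most `(D + 2) * K` elements. -/
lemma card_le_of_card_slice_le {α : Type*} (s : Finset α) (g : α → ℝ) {D K : ℝ}
    (hD : 0 ≤ D) (hK : 0 ≤ K) (hg : ∀ x ∈ s, ∀ y ∈ s, |g x - g y| ≤ D)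
    (h : ∀ t ⊆ s, (∀ x ∈ t, ∀ y ∈ t, |g x - g y| < 1) → (t.card : ℝ) ≤ K) :
    (s.card : ℝ) ≤ (D + 2) * K := by
  rcases s.eq_empty_or_nonempty with rfl | hs
  · simp; positivity
  obtain ⟨z, hz, hmin⟩ := s.exists_min_image g hs
  have himg : s.image (fun x => ⌊g x⌋) ⊆ Finset.Icc ⌊g z⌋ ⌊g z + D⌋ := by
    intro k hk
    obtain ⟨x, hx, rfl⟩ := Finset.mem_image.1 hk
    rw [Finset.mem_Icc]
    refine ⟨Int.floor_mono (hmin x hx), Int.floor_mono ?_⟩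
    linarith [(abs_le.1 (hg x hx z hz)).2]
  have hcard : ((s.image (fun x => ⌊g x⌋)).card : ℝ) ≤ D + 2 := by
    have h1 : ((s.image (fun x => ⌊g x⌋)).card : ℝ) ≤ ((Finset.Icc ⌊g z⌋ ⌊g z + D⌋).card : ℝ) := by
      exact_mod_cast Finset.card_le_card himg
    have h2 : ((Finset.Icc ⌊g z⌋ ⌊g z + D⌋).card : ℤ) = ⌊g z + D⌋ + 1 - ⌊g z⌋ := by
      rw [Int.card_Icc, Int.toNat_of_nonneg]
      have : ⌊g z⌋ ≤ ⌊g z + D⌋ := Int.floor_mono (by linarith)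
      omega
    have h3 : ((Finset.Icc ⌊g z⌋ ⌊g z + D⌋).card : ℝ) = ⌊g z + D⌋ + 1 - ⌊g z⌋ := by
      exact_mod_cast h2
    linarith [Int.floor_le (g z + D), Int.lt_floor_add_one (g z)]
  have hfib : ∀ k ∈ s.image (fun x => ⌊g x⌋),
      (s.filter (fun x => ⌊g x⌋ = k)).card ≤ ⌊K⌋₊ := by
    intro k _
    refine Nat.le_floor (h _ (Finset.filter_subset _ _) fun x hx y hy => ?_)
    exact Int.abs_sub_lt_one_of_floor_eq_floor
      ((Finset.mem_filter.1 hx).2.trans (Finset.mem_filter.1 hy).2.symm)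
  have htot := Finset.card_le_mul_card_image s ⌊K⌋₊ hfib
  calc (s.card : ℝ) ≤ (⌊K⌋₊ : ℝ) * ((s.image (fun x => ⌊g x⌋)).card : ℝ) := by exact_mod_cast htot
    _ ≤ K * (D + 2) := by gcongr; exact Nat.floor_le hK
    _ = (D + 2) * K := mul_comm _ _

lemma znorm_sq (x : Fin 2 → ℤ) : znorm x ^ 2 = (x 0 : ℝ) ^ 2 + (x 1 : ℝ) ^ 2 :=
  Real.sq_sqrt (by positivity)

lemma znorm_nonneg (x : Fin 2 → ℤ) : 0 ≤ znorm x := Real.sqrt_nonneg _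

lemma jb_sq (x : Fin 2 → ℤ) : jb x ^ 2 = 1 + (x 0 : ℝ) ^ 2 + (x 1 : ℝ) ^ 2 :=
  Real.sq_sqrt (by positivity)

lemma jb_nonneg (x : Fin 2 → ℤ) : 0 ≤ jb x := Real.sqrt_nonneg _

lemma jb_le_of_znorm_le {x : Fin 2 → ℤ} {N : ℝ} (hN : 1 ≤ N) (hx : znorm x ≤ 2 * N) :
    jb x ≤ 3 * N := by
  refine abs_le_of_sq_le_sq' ?_ (by linarith) |>.2
  nlinarith [jb_sq x, znorm_sq x, znorm_nonneg x]

/-- The coordinate of `n` along `a`. -/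
noncomputable def parCoord (a n : Fin 2 → ℤ) : ℝ :=
  ((a 0 : ℝ) * n 0 + (a 1 : ℝ) * n 1) / znorm a

/-- The coordinate of `n` orthogonal to `a`. -/
noncomputable def perpCoord (a n : Fin 2 → ℤ) : ℝ :=
  ((a 0 : ℝ) * n 1 - (a 1 : ℝ) * n 0) / znorm a

lemma znorm_mul_parCoord {a : Fin 2 → ℤ} (ha : 0 < znorm a) (n : Fin 2 → ℤ) :
    znorm a * parCoord a n = (a 0 : ℝ) * n 0 + (a 1 : ℝ) * n 1 :=
  mul_div_cancel₀ _ ha.ne'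

lemma parCoord_sub_sq_add_perpCoord_sub_sq {a : Fin 2 → ℤ} (ha : 0 < znorm a) (x y : Fin 2 → ℤ) :
    (parCoord a x - parCoord a y) ^ 2 + (perpCoord a x - perpCoord a y) ^ 2 =
      ((x 0 : ℝ) - y 0) ^ 2 + ((x 1 : ℝ) - y 1) ^ 2 := by
  unfold parCoord perpCoord
  rw [← sub_div, ← sub_div, div_pow, div_pow, ← add_div, div_eq_iff (by positivity), znorm_sq]
  ring

lemma parCoord_sq_add_perpCoord_sq {a : Fin 2 → ℤ} (ha : 0 < znorm a) (x : Fin 2 → ℤ) :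
    parCoord a x ^ 2 + perpCoord a x ^ 2 = znorm x ^ 2 := by
  have := parCoord_sub_sq_add_perpCoord_sub_sq ha x 0
  simpa [parCoord, perpCoord, znorm_sq] using this

lemma abs_parCoord_le {a : Fin 2 → ℤ} (ha : 0 < znorm a) (x : Fin 2 → ℤ) :
    |parCoord a x| ≤ znorm x := by
  refine abs_le_of_sq_le_sq ?_ (znorm_nonneg x)
  nlinarith [parCoord_sq_add_perpCoord_sq ha x, sq_nonneg (perpCoord a x)]

lemma znorm_le_jb (x : Fin 2 → ℤ) : znorm x ≤ jb x :=
  Real.sqrt_le_sqrt (by linarith)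

lemma jb_add_sq {a : Fin 2 → ℤ} (ha : 0 < znorm a) (n : Fin 2 → ℤ) :
    jb (a + n) ^ 2 = jb n ^ 2 + znorm a ^ 2 + 2 * (znorm a * parCoord a n) := by
  rw [jb_sq, jb_sq, znorm_sq, znorm_mul_parCoord ha]
  simp only [Pi.add_apply]
  push_cast
  ring

lemma abs_jb_add_sub_jb_le {a : Fin 2 → ℤ} (ha : 0 < znorm a) (n : Fin 2 → ℤ) :
    |jb (a + n) - jb n| ≤ znorm a := by
  have hu := abs_le.1 (abs_parCoord_le ha n)
  have hw := abs_le.1 (abs_parCoord_le ha (a + n))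
  have hpar : znorm a * parCoord a (a + n) = znorm a ^ 2 + znorm a * parCoord a n := by
    rw [znorm_mul_parCoord ha, znorm_mul_parCoord ha, znorm_sq]
    simp only [Pi.add_apply]
    push_cast
    ring
  have hsq := jb_add_sq ha n
  have h1 : jb (a + n) ≤ jb n + znorm a := by
    refine abs_le_of_sq_le_sq' ?_ (by linarith [jb_nonneg n]) |>.2
    nlinarith [mul_le_mul_of_nonneg_left (hu.2.trans (znorm_le_jb n)) ha.le]
  have h2 : jb n ≤ jb (a + n) + znorm a := by
    refine abs_le_of_sq_le_sq' ?_ (by linarith [jb_nonneg (a + n)]) |>.2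
    have : -jb (a + n) ≤ parCoord a (a + n) := by linarith [znorm_le_jb (a + n)]
    nlinarith [mul_le_mul_of_nonneg_left this ha.le]
  rw [abs_le]
  constructor <;> linarith

/-- On a slab of the hyperbolic set where the bracket varies by at most `L`, the coordinate along
`a` varies by at most a multiple of `L`. -/
lemma abs_parCoord_sub_le {a x y : Fin 2 → ℤ} {m : ℤ} {A N L : ℝ} (hN : 1 ≤ N) (hA : 1 ≤ A)
    (hL : 1 ≤ L) (hNAL : N ≤ A * L) (ha : ann A a) (hx : x ∈ hypSet N a m) (hy : y ∈ hypSet N a m)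
    (hAL : A * |jb x - jb y| ≤ A * L) : |parCoord a x - parCoord a y| ≤ 24 * L := by
  have ha0 : 0 < znorm a := by linarith [ha.1]
  have hδ : |(jb (a + x) - jb x) - (jb (a + y) - jb y)| ≤ 2 := by
    have h1 := abs_le.1 hx.2
    have h2 := abs_le.1 hy.2
    rw [abs_le]
    constructor <;> linarith
  have hδx := (abs_jb_add_sub_jb_le ha0 x).trans ha.2
  have hδy := (abs_jb_add_sub_jb_le ha0 y).trans ha.2
  have hsx := jb_add_sq ha0 x
  have hsy := jb_add_sq ha0 y
  have hty := jb_le_of_znorm_le hN hy.1.2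
  have hty0 := jb_nonneg y
  set δ := jb (a + x) - jb x with hδ_def
  set ε := jb (a + y) - jb y with hε_def
  have hid : 2 * (znorm a * (parCoord a x - parCoord a y)) =
      (δ - ε) * (δ + ε) + 2 * (δ * (jb x - jb y)) + 2 * (jb y * (δ - ε)) := by
    rw [hδ_def, hε_def]
    linear_combination hsy - hsx
  have hAA : A ≤ A * L := le_mul_of_one_le_right (by linarith) hL
  have e1 : |(δ - ε) * (δ + ε)| ≤ 2 * (4 * A) := by
    rw [abs_mul]
    exact mul_le_mul hδ ((abs_add_le _ _).trans (by linarith)) (abs_nonneg _) (by norm_num)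
  have e2 : |δ * (jb x - jb y)| ≤ 2 * (A * L) := by
    rw [abs_mul]
    nlinarith [mul_le_mul_of_nonneg_right hδx (abs_nonneg (jb x - jb y))]
  have e3 : |jb y * (δ - ε)| ≤ 3 * N * 2 := by
    rw [abs_mul, abs_of_nonneg hty0]
    exact mul_le_mul hty hδ (abs_nonneg _) (by linarith)
  have hmain : |znorm a * (parCoord a x - parCoord a y)| ≤ 12 * (A * L) := by
    rw [abs_le] at e1 e2 e3 ⊢
    constructor <;> linarith
  rw [abs_mul, abs_of_pos ha0] at hmain
  have := mul_le_mul_of_nonneg_right ha.1 (abs_nonneg (parCoord a x - parCoord a y))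
  refine le_of_mul_le_mul_left ?_ (show 0 < A by linarith)
  linarith

lemma sq_abs_sub_abs_le (p q : ℝ) : (|p| - |q|) ^ 2 ≤ |p ^ 2 - q ^ 2| := by
  rw [← sq_abs p, ← sq_abs q, sq_sub_sq, abs_mul, abs_of_nonneg (by positivity : 0 ≤ |p| + |q|),
    ← sq_abs (|p| - |q|), sq]
  refine mul_le_mul_of_nonneg_right ?_ (abs_nonneg _)
  rw [abs_le]
  constructor <;> linarith [abs_nonneg p, abs_nonneg q]

lemma abs_perpCoord_sub_le {a x y : Fin 2 → ℤ} {N L : ℝ} (hN : 1 ≤ N) (hL : 0 ≤ L)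
    (ha : 0 < znorm a) (hx : ann N x) (hy : ann N y) (ht : |jb x - jb y| ≤ L)
    (hu : |parCoord a x - parCoord a y| ≤ 24 * L) :
    |(|perpCoord a x| - |perpCoord a y|)| ≤ 11 * Real.sqrt (N * L) := by
  have hsq : (11 * Real.sqrt (N * L)) ^ 2 = 121 * (N * L) := by
    rw [mul_pow, Real.sq_sqrt (by positivity)]
    norm_num
  refine abs_le_of_sq_le_sq ((sq_abs_sub_abs_le _ _).trans ?_) (by positivity)
  have hid : perpCoord a x ^ 2 - perpCoord a y ^ 2 = (jb x - jb y) * (jb x + jb y) -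
      (parCoord a x - parCoord a y) * (parCoord a x + parCoord a y) := by
    linear_combination parCoord_sq_add_perpCoord_sq ha x - parCoord_sq_add_perpCoord_sq ha y
      + znorm_sq x - znorm_sq y - jb_sq x + jb_sq y
  have e1 : |(jb x - jb y) * (jb x + jb y)| ≤ L * (6 * N) := by
    rw [abs_mul, abs_of_nonneg (add_nonneg (jb_nonneg x) (jb_nonneg y))]
    exact mul_le_mul ht (by linarith [jb_le_of_znorm_le hN hx.2, jb_le_of_znorm_le hN hy.2])
      (add_nonneg (jb_nonneg x) (jb_nonneg y)) hL
  have e2 : |(parCoord a x - parCoord a y) * (parCoord a x + parCoord a y)| ≤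
      24 * L * (4 * N) := by
    rw [abs_mul]
    refine mul_le_mul hu ((abs_add_le _ _).trans ?_) (abs_nonneg _) (by positivity)
    linarith [abs_parCoord_le ha x, abs_parCoord_le ha y, hx.2, hy.2]
  rw [hid, hsq]
  refine (abs_sub _ _).trans ?_
  nlinarith [mul_nonneg (zero_le_one.trans hN) hL]

/-- A set of lattice points contained in an open rotated unit square is small. -/
lemma card_le_of_coord_sub_lt_one {a : Fin 2 → ℤ} (ha : 0 < znorm a) (s : Finset (Fin 2 → ℤ))
    (hu : ∀ x ∈ s, ∀ y ∈ s, |parCoord a x - parCoord a y| < 1)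
    (hv : ∀ x ∈ s, ∀ y ∈ s, |perpCoord a x - perpCoord a y| < 1) : (s.card : ℝ) ≤ 16 := by
  have hdist : ∀ x ∈ s, ∀ y ∈ s, ((x 0 : ℝ) - y 0) ^ 2 + ((x 1 : ℝ) - y 1) ^ 2 ≤ 2 ^ 2 := by
    intro x hx y hy
    rw [← parCoord_sub_sq_add_perpCoord_sub_sq ha]
    linarith [(sq_lt_one_iff_abs_lt_one _).2 (hu x hx y hy),
      (sq_lt_one_iff_abs_lt_one _).2 (hv x hx y hy)]
  have key : (s.card : ℝ) ≤ (2 + 2) * ((2 + 2) * 1) := by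
    refine card_le_of_card_slice_le s (fun x => (x 0 : ℝ)) (by norm_num) (by norm_num)
      (fun x hx y hy => abs_le_of_sq_le_sq
        (by nlinarith [hdist x hx y hy, sq_nonneg ((x 1 : ℝ) - y 1)]) (by norm_num)) ?_
    intro t hts ht
    refine card_le_of_card_slice_le t (fun x => (x 1 : ℝ)) (by norm_num) (by norm_num)
      (fun x hx y hy => abs_le_of_sq_le_sq
        (by nlinarith [hdist x (hts hx) y (hts hy), sq_nonneg ((x 0 : ℝ) - y 0)])
        (by norm_num)) ?_
    intro r hrt hr
    have : r.card ≤ 1 := by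
      refine Finset.card_le_one.2 fun x hx y hy => ?_
      have h0 : |x 0 - y 0| < 1 := by exact_mod_cast ht x (hrt hx) y (hrt hy)
      have h1 : |x 1 - y 1| < 1 := by exact_mod_cast hr x hx y hy
      rw [Int.abs_lt_one_iff, sub_eq_zero] at h0 h1
      ext i
      fin_cases i
      · exact h0
      · exact h1
    exact_mod_cast this
  linarith

lemma finite_hypSet (N : ℝ) (a : Fin 2 → ℤ) (m : ℤ) : (hypSet N a m).Finite := by
  refine (Set.finite_Icc (fun _ : Fin 2 => -⌈2 * N⌉) (fun _ => ⌈2 * N⌉)).subset ?_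
  intro x hx
  have hN0 : (0 : ℝ) ≤ 2 * N := (znorm_nonneg x).trans hx.1.2
  have hb : ∀ i, |x i| ≤ ⌈2 * N⌉ := by
    intro i
    have h : |(x i : ℝ)| ≤ 2 * N := by
      refine abs_le_of_sq_le_sq ?_ hN0
      have hsq := pow_le_pow_left₀ (znorm_nonneg x) hx.1.2 2
      rw [znorm_sq] at hsq
      fin_cases i
      · exact le_trans (by simp [sq_nonneg]) hsq
      · exact le_trans (by simp [sq_nonneg]) hsq
    have : ((|x i| : ℤ) : ℝ) ≤ ⌈2 * N⌉ := by
      push_cast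
      exact h.trans (Int.le_ceil _)
    exact_mod_cast this
  exact ⟨fun i => (abs_le.1 (hb i)).1, fun i => (abs_le.1 (hb i)).2⟩

lemma card_hypSet_le {a : Fin 2 → ℤ} {m : ℤ} {A N M L : ℝ} (hA : 1 ≤ A) (hN : 1 ≤ N) (hM : 0 ≤ M)
    (hL : 1 ≤ L) (hML : M * L = N) (hNAL : N ≤ A * L) (ha : ann A a) (s : Finset (Fin 2 → ℤ))
    (hs : ∀ x ∈ s, x ∈ hypSet N a m) :
    (s.card : ℝ) ≤
      (3 * M + 2) * ((24 * L + 2) * ((11 * Real.sqrt (N * L) + 2) * ((1 + 2) * 16))) := by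
  have hL0 : 0 < L := by linarith
  have ha0 : 0 < znorm a := by linarith [ha.1]
  refine card_le_of_card_slice_le s (fun x => jb x / L) (by positivity) (by positivity) ?_ ?_
  · intro x hx y hy
    rw [← sub_div, abs_div, abs_of_pos hL0, div_le_iff₀ hL0, mul_assoc, hML, abs_le]
    have h1 := jb_le_of_znorm_le hN (hs x hx).1.2
    have h2 := jb_le_of_znorm_le hN (hs y hy).1.2
    constructor <;> linarith [jb_nonneg x, jb_nonneg y]
  intro t hts ht
  have ht' : ∀ x ∈ t, ∀ y ∈ t, |jb x - jb y| ≤ L := by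
    intro x hx y hy
    have := ht x hx y hy
    rw [← sub_div, abs_div, abs_of_pos hL0, div_lt_one hL0] at this
    exact this.le
  have hu : ∀ x ∈ t, ∀ y ∈ t, |parCoord a x - parCoord a y| ≤ 24 * L := fun x hx y hy =>
    abs_parCoord_sub_le hN hA hL hNAL ha (hs x (hts hx)) (hs y (hts hy))
      (mul_le_mul_of_nonneg_left (ht' x hx y hy) (by linarith))
  refine card_le_of_card_slice_le t (parCoord a) (by positivity) (by positivity) hu ?_
  intro r hrt hr
  refine card_le_of_card_slice_le r (fun x => |perpCoord a x|) (by positivity) (by positivity)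
    (fun x hx y hy => abs_perpCoord_sub_le hN hL0.le ha0 (hs x (hts (hrt hx))).1
      (hs y (hts (hrt hy))).1 (ht' x (hrt hx) y (hrt hy)) (hu x (hrt hx) y (hrt hy))) ?_
  intro q hqr hq
  refine card_le_of_card_slice_le q (fun x => if 0 ≤ perpCoord a x then 1 else 0) (by positivity)
    (by positivity) (fun x _ y _ => by split_ifs <;> norm_num) ?_
  intro p hpq hp
  refine card_le_of_coord_sub_lt_one ha0 p
    (fun x hx y hy => hr x (hqr (hpq hx)) y (hqr (hpq hy))) fun x hx y hy => ?_
  have habs := hq x (hpq hx) y (hpq hy)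
  have hsign := hp x hx y hy
  beta_reduce at habs hsign
  split_ifs at hsign with h1 h2 h2
  · rwa [abs_of_nonneg h1, abs_of_nonneg h2] at habs
  · norm_num at hsign
  · norm_num at hsign
  · rw [abs_of_neg (not_le.1 h1), abs_of_neg (not_le.1 h2)] at habs
    rw [abs_sub_comm]
    convert habs using 2
    ring

/-- basic counting estimate, hyperbolic case: there is a universal `C > 0` such
that for all dyadic `A = 2^kA`, `N = 2^kN`, every `a ∈ ℤ²` with `|a| ∼ A`, and every `m ∈ ℤ`,
`#{n : |n| ∼ N, |⟨a+n⟩ − ⟨n⟩ − m| ≤ 1} ≤ C N² / min(A,N)^{1/2}`. -/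
theorem basic_counting_hyperbolic :
    ∃ C : ℝ, 0 < C ∧
      ∀ (kA kN : ℕ) (a : Fin 2 → ℤ) (m : ℤ), ann ((2 : ℝ) ^ kA) a →
        (hypSet ((2 : ℝ) ^ kN) a m).Finite ∧
        ((hypSet ((2 : ℝ) ^ kN) a m).ncard : ℝ) ≤
          C * ((2 : ℝ) ^ kN) ^ 2 / Real.sqrt (min ((2 : ℝ) ^ kA) ((2 : ℝ) ^ kN)) := by
  refine ⟨5 * 26 * 13 * 48, by norm_num, fun kA kN a m ha => ⟨finite_hypSet _ a m, ?_⟩⟩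
  have hA : (1 : ℝ) ≤ 2 ^ kA := one_le_pow₀ (by norm_num)
  have hN : (1 : ℝ) ≤ 2 ^ kN := one_le_pow₀ (by norm_num)
  generalize (2 : ℝ) ^ kA = A at *
  generalize (2 : ℝ) ^ kN = N at *
  have hM : 1 ≤ min A N := le_min hA hN
  have hMA : min A N ≤ A := min_le_left _ _
  have hMN : min A N ≤ N := min_le_right _ _
  generalize min A N = M at *
  have hM0 : 0 < M := by linarith
  have hL : 1 ≤ N / M := (one_le_div hM0).2 hMN
  have hML : M * (N / M) = N := mul_div_cancel₀ _ hM0.ne'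
  have hcard := card_hypSet_le (m := m) hA hN hM0.le hL hML
    (by nlinarith) ha (finite_hypSet N a m).toFinset (fun x hx => by simpa using hx)
  rw [Set.ncard_eq_toFinset_card _ (finite_hypSet N a m)]
  have hsqrt : Real.sqrt (N * (N / M)) = N / Real.sqrt M := by
    rw [← mul_div_assoc, Real.sqrt_div (by positivity), Real.sqrt_mul_self (by linarith)]
  have hsqrt1 : 1 ≤ Real.sqrt (N * (N / M)) := by
    rw [Real.one_le_sqrt]
    nlinarith
  refine hcard.trans ?_
  calc (3 * M + 2) * ((24 * (N / M) + 2) *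
        ((11 * Real.sqrt (N * (N / M)) + 2) * ((1 + 2) * 16)))
      ≤ (5 * M) * ((26 * (N / M)) * ((13 * Real.sqrt (N * (N / M))) * ((1 + 2) * 16))) := by
        gcongr <;> linarith
    _ = 5 * 26 * 13 * 48 * (M * (N / M)) * Real.sqrt (N * (N / M)) := by ring
    _ = 5 * 26 * 13 * 48 * N ^ 2 / Real.sqrt M := by rw [hML, hsqrt]; ring
end

section
/- There exists a universal constant C > 0 with the following property: for all dyadic numbers A, N, every a ∈ ℤ² with |a| ∼ A, and every m ∈ ℤ, the cardinality of the set { n ∈ ℤ² : |n| ∼ N and |⟨a + n⟩ + ⟨n⟩ − m| ≤ 1 } is at most C · N^{3/2}. -/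
/-- The counting set of the elliptic basic counting estimate. -/
def ellSet (N : ℝ) (a : Fin 2 → ℤ) (m : ℤ) : Set (Fin 2 → ℤ) :=
  {n | ann N n ∧ |jb (a + n) + jb n - (m : ℝ)| ≤ 1}

/-- A quantitative tangent line inequality for the strongly convex function `y ↦ √(b + y²)`. -/
theorem sqrt_add_sq_ge_tangent {b y z μ H : ℝ} (hb : 0 < b) (hμ : 0 ≤ μ)
    (hy : √(b + y ^ 2) ≤ H) (hz : √(b + z ^ 2) ≤ H) (hH : 2 * μ * H ^ 3 ≤ b) :
    √(b + z ^ 2) + z / √(b + z ^ 2) * (y - z) + μ * (y - z) ^ 2 ≤ √(b + y ^ 2) := by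
  have hs2 : √(b + y ^ 2) ^ 2 = b + y ^ 2 := Real.sq_sqrt (by positivity)
  have ht2 : √(b + z ^ 2) ^ 2 = b + z ^ 2 := Real.sq_sqrt (by positivity)
  have hs : 0 < √(b + y ^ 2) := Real.sqrt_pos.2 (by positivity)
  have ht : 0 < √(b + z ^ 2) := Real.sqrt_pos.2 (by positivity)
  generalize √(b + y ^ 2) = s at *
  generalize √(b + z ^ 2) = t at *
  have hprod : (s * t - (b + z * y)) * (s * t + (b + z * y)) = b * (y - z) ^ 2 := by
    linear_combination t ^ 2 * hs2 + (b + y ^ 2) * ht2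
  have hst : 0 < s * t := mul_pos hs ht
  have habs : |b + z * y| ≤ s * t := by
    apply abs_le_of_sq_le_sq _ hst.le
    nlinarith [mul_nonneg hb.le (sq_nonneg (y - z))]
  have hq := (le_abs_self _).trans habs
  have hstt : s * t * t ≤ H ^ 3 := by
    have hH0 : 0 ≤ H := hs.le.trans hy
    calc s * t * t ≤ H * H * H := by gcongr
      _ = H ^ 3 := by ring
  have hmain : b + z * y + μ * t * (y - z) ^ 2 ≤ s * t := by
    by_contra! hlt
    have h1 : b * (y - z) ^ 2 ≤ (s * t - (b + z * y)) * (2 * (s * t)) := by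
      rw [← hprod]
      exact mul_le_mul_of_nonneg_left (by linarith) (by linarith)
    have h2 : (s * t - (b + z * y)) * (2 * (s * t)) < μ * t * (y - z) ^ 2 * (2 * (s * t)) :=
      mul_lt_mul_of_pos_right (by linarith) (by positivity)
    have h3 : μ * t * (y - z) ^ 2 * (2 * (s * t)) ≤ b * (y - z) ^ 2 := by
      calc μ * t * (y - z) ^ 2 * (2 * (s * t)) = 2 * μ * (s * t * t) * (y - z) ^ 2 := by ring
        _ ≤ 2 * μ * H ^ 3 * (y - z) ^ 2 := by gcongr
        _ ≤ b * (y - z) ^ 2 := by gcongr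
    linarith
  have heq : t + z / t * (y - z) + μ * (y - z) ^ 2
      = (b + z * y + μ * t * (y - z) ^ 2) / t := by
    field_simp
    linear_combination ht2
  rw [heq, div_le_iff₀ ht]
  exact hmain

/-- A finite set of integers in which every interior element is within distance `K` of one of any
two elements surrounding it has at most `2 (K + 1)` elements. -/
theorem card_le_of_three_point {S : Finset ℤ} {K : ℕ}
    (h : ∀ x ∈ S, ∀ y ∈ S, ∀ z ∈ S, x < y → y < z → z - y ≤ K ∨ y - x ≤ K) :
    S.card ≤ 2 * (K + 1) := by
  rcases S.eq_empty_or_nonempty with rfl | hne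
  · simp
  have hsub : S ⊆ Finset.Icc (S.min' hne) (S.min' hne + K) ∪
      Finset.Icc (S.max' hne - K) (S.max' hne) := by
    intro y hy
    have h1 := S.min'_le y hy
    have h2 := S.le_max' y hy
    have h3 := h _ (S.min'_mem hne) y hy _ (S.max'_mem hne)
    simp only [Finset.mem_union, Finset.mem_Icc]
    omega
  calc S.card ≤ _ := Finset.card_le_card hsub
    _ ≤ _ := Finset.card_union_le _ _
    _ ≤ 2 * (K + 1) := by simp only [Int.card_Icc]; omega

/-- If `√(b + y²) + √(c + (d + y)²)` differs from `m` by at most `1` at three points, then the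
middle one is close to one of the other two. -/
theorem sub_sq_le_of_three_point {N b c d m x y z : ℝ} (hN : 0 < N) (hb : N ^ 2 / 8 ≤ b)
    (hc : 0 < c)
    (hbound : ∀ w ∈ ({x, y, z} : Set ℝ), √(b + w ^ 2) ≤ 3 * N)
    (hm : ∀ w ∈ ({x, y, z} : Set ℝ), |√(c + (d + w) ^ 2) + √(b + w ^ 2) - m| ≤ 1)
    (hxy : x ≤ y) (hyz : y ≤ z) :
    (z - y) ^ 2 ≤ 900 * N ∨ (y - x) ^ 2 ≤ 900 * N := by
  set p := y / √(b + y ^ 2) + (d + y) / √(c + (d + y) ^ 2) with hp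
  have hb0 : 0 < b := lt_of_lt_of_le (by positivity) hb
  have key : ∀ w ∈ ({x, y, z} : Set ℝ), p * (w - y) + 1 / (432 * N) * (w - y) ^ 2 ≤ 2 := by
    intro w hw
    have hy : y ∈ ({x, y, z} : Set ℝ) := by simp
    have h1 := sqrt_add_sq_ge_tangent (μ := 1 / (432 * N)) hb0 (by positivity)
      (hbound w hw) (hbound y hy) (le_trans (le_of_eq (by field_simp; norm_num)) hb)
    have h2 := sqrt_add_sq_ge_tangent (μ := 0) hc le_rfl
      (le_max_left √(c + (d + w) ^ 2) √(c + (d + y) ^ 2)) (le_max_right _ _) (by simpa using hc.le)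
    have h3 := (abs_le.1 (hm w hw)).2
    have h4 := (abs_le.1 (hm y hy)).1
    rw [hp, add_mul]
    have h5 : d + w - (d + y) = w - y := by ring
    rw [h5] at h2
    linarith
  have finish : ∀ w : ℝ, 1 / (432 * N) * (w - y) ^ 2 ≤ 2 → (w - y) ^ 2 ≤ 900 * N := by
    intro w hw
    rw [one_div_mul_eq_div, div_le_iff₀ (by positivity)] at hw
    linarith
  rcases le_total 0 p with h | h
  · left
    have := mul_nonneg h (sub_nonneg.2 hyz)
    exact finish z (by linarith [key z (by simp)])
  · right
    have := mul_nonneg_of_nonpos_of_nonpos h (sub_nonpos.2 hxy)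
    have := finish x (by linarith [key x (by simp)])
    nlinarith

theorem ann.sq_bounds {N : ℝ} (hN : 0 ≤ N) {x : Fin 2 → ℤ} (h : ann N x) :
    N ^ 2 / 4 ≤ (x 0 : ℝ) ^ 2 + (x 1 : ℝ) ^ 2 ∧
      (x 0 : ℝ) ^ 2 + (x 1 : ℝ) ^ 2 ≤ 4 * N ^ 2 := by
  obtain ⟨h1, h2⟩ := h
  have hs : znorm x ^ 2 = (x 0 : ℝ) ^ 2 + (x 1 : ℝ) ^ 2 := Real.sq_sqrt (by positivity)
  rw [← hs]
  constructor <;> nlinarith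

theorem ann.abs_le {N : ℕ} {x : Fin 2 → ℤ} (h : ann N x) (i : Fin 2) :
    |x i| ≤ 2 * (N : ℤ) := by
  have h2 := (h.sq_bounds (Nat.cast_nonneg N)).2
  have : (x i : ℝ) ^ 2 ≤ (2 * N) ^ 2 := by
    have h0 := sq_nonneg (x 0 : ℝ)
    have h1 := sq_nonneg (x 1 : ℝ)
    fin_cases i <;> simp only [Fin.zero_eta, Fin.mk_one] <;> linarith
  have := abs_le_of_sq_le_sq this (by positivity)
  exact_mod_cast this

/-- Each line on which coordinate `i` is constant and dominant contains `O(√N)` points of the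
counting set. -/
theorem card_fiber_le {N : ℕ} (hN : 1 ≤ N) {a : Fin 2 → ℤ} {m : ℤ} {i j : Fin 2} (hij : i ≠ j)
    {F : Finset (Fin 2 → ℤ)} (hF : ∀ n ∈ F, n ∈ ellSet N a m)
    (hdom : ∀ n ∈ F, |n j| ≤ |n i|) (k : ℤ) (hk : ∀ n ∈ F, n i = k) :
    F.card ≤ 2 * (⌊30 * √(N : ℝ)⌋₊ + 1) := by
  have hcases : ∀ l : Fin 2, l = i ∨ l = j := by omega
  have hjb : ∀ x : Fin 2 → ℤ, jb x = √(1 + (x i : ℝ) ^ 2 + (x j : ℝ) ^ 2) := by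
    intro x
    fin_cases i <;> fin_cases j <;> simp_all [jb, add_right_comm]
  have hsum : ∀ x : Fin 2 → ℤ,
      (x 0 : ℝ) ^ 2 + (x 1 : ℝ) ^ 2 = (x i : ℝ) ^ 2 + (x j : ℝ) ^ 2 := by
    intro x
    fin_cases i <;> fin_cases j <;> simp_all [add_comm]
  have hN' : (1 : ℝ) ≤ N := by exact_mod_cast hN
  have hinj : Set.InjOn (fun n : Fin 2 → ℤ => n j) F := by
    intro n hn n' hn' h
    ext l
    rcases hcases l with rfl | rfl
    · rw [hk n hn, hk n' hn']
    · exact h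
  rw [← Finset.card_image_of_injOn hinj]
  apply card_le_of_three_point
  have hprop : ∀ n ∈ F, (N : ℝ) ^ 2 / 8 ≤ 1 + (k : ℝ) ^ 2 ∧
      √(1 + (k : ℝ) ^ 2 + (n j : ℝ) ^ 2) ≤ 3 * N ∧
      |√(1 + ((a i : ℝ) + k) ^ 2 + ((a j : ℝ) + n j) ^ 2) + √(1 + (k : ℝ) ^ 2 + (n j : ℝ) ^ 2) - m|
        ≤ 1 := by
    intro n hn
    obtain ⟨hann, habs⟩ := hF n hn
    obtain ⟨h1, h2⟩ := hann.sq_bounds (by positivity)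
    have hd : (n j : ℝ) ^ 2 ≤ (n i : ℝ) ^ 2 := by exact_mod_cast sq_le_sq.2 (hdom n hn)
    rw [hjb, hjb] at habs
    rw [hsum] at h1 h2
    simp only [Pi.add_apply, Int.cast_add, hk n hn] at h1 h2 hd habs
    refine ⟨by linarith, ?_, habs⟩
    rw [Real.sqrt_le_left (by positivity)]
    nlinarith
  have hK : ∀ u v : ℤ, ((u : ℝ) - v) ^ 2 ≤ 900 * N → u - v ≤ (⌊30 * √(N : ℝ)⌋₊ : ℤ) := by
    intro u v h
    rw [Int.natCast_floor_eq_floor (by positivity), Int.le_floor]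
    push_cast
    refine (abs_le.1 (abs_le_of_sq_le_sq (h.trans_eq ?_) (by positivity))).2
    rw [mul_pow, Real.sq_sqrt (by positivity)]
    norm_num
  simp only [Finset.mem_image, forall_exists_index, and_imp, forall_apply_eq_imp_iff₂]
  intro n₁ h₁ n₂ h₂ n₃ h₃ h12 h23
  obtain ⟨hb, b1, c1⟩ := hprop n₁ h₁
  obtain ⟨-, b2, c2⟩ := hprop n₂ h₂
  obtain ⟨-, b3, c3⟩ := hprop n₃ h₃
  refine (sub_sq_le_of_three_point (N := N) (b := 1 + (k : ℝ) ^ 2)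
    (c := 1 + ((a i : ℝ) + k) ^ 2) (d := a j) (m := m) (x := n₁ j) (y := n₂ j) (z := n₃ j)
    (by linarith) hb (by positivity) ?_ ?_ (by exact_mod_cast h12.le)
    (by exact_mod_cast h23.le)).imp (hK _ _) (hK _ _)
  · rintro w (rfl | rfl | rfl) <;> assumption
  · rintro w (rfl | rfl | rfl) <;> assumption

/-- The counting estimate on the region where coordinate `i` dominates. -/
theorem card_dominant_le {N : ℕ} (hN : 1 ≤ N) {a : Fin 2 → ℤ} {m : ℤ} {i j : Fin 2} (hij : i ≠ j)
    {F : Finset (Fin 2 → ℤ)} (hF : ∀ n ∈ F, n ∈ ellSet N a m)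
    (hdom : ∀ n ∈ F, |n j| ≤ |n i|) :
    F.card ≤ 2 * (⌊30 * √(N : ℝ)⌋₊ + 1) * (4 * N + 1) := by
  have hmaps : ∀ n ∈ F, n i ∈ Finset.Icc (-(2 * N : ℤ)) (2 * N) := fun n hn =>
    Finset.mem_Icc.2 (_root_.abs_le.1 ((hF n hn).1.abs_le i))
  refine (Finset.card_le_mul_card_image_of_maps_to hmaps _ fun k _ =>
    card_fiber_le (a := a) (m := m) hN hij (fun n hn => hF n (Finset.mem_filter.1 hn).1)
      (fun n hn => hdom n (Finset.mem_filter.1 hn).1) k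
      (fun n hn => (Finset.mem_filter.1 hn).2)).trans ?_
  gcongr
  rw [Int.card_Icc]
  omega

theorem ellSet_finite (N : ℕ) (a : Fin 2 → ℤ) (m : ℤ) : (ellSet N a m).Finite :=
  (Set.finite_Icc (fun _ => -(2 * N : ℤ)) (fun _ => (2 * N : ℤ))).subset fun _ hn =>
    ⟨fun i => (abs_le.1 (hn.1.abs_le i)).1, fun i => (abs_le.1 (hn.1.abs_le i)).2⟩

theorem ellSet_ncard_le {N : ℕ} (hN : 1 ≤ N) (a : Fin 2 → ℤ) (m : ℤ) :
    ((ellSet N a m).ncard : ℝ) ≤ 620 * (N : ℝ) ^ ((3 : ℝ) / 2) := by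
  have hfin := ellSet_finite N a m
  rw [Set.ncard_eq_toFinset_card _ hfin,
    ← Finset.card_filter_add_card_filter_not (fun n : Fin 2 → ℤ => |n 1| ≤ |n 0|)]
  have h0 := card_dominant_le (a := a) (m := m) (i := 0) (j := 1)
    (F := hfin.toFinset.filter fun n => |n 1| ≤ |n 0|) hN (by decide)
    (fun n hn => hfin.mem_toFinset.1 (Finset.mem_filter.1 hn).1)
    (fun n hn => (Finset.mem_filter.1 hn).2)
  have h1 := card_dominant_le (a := a) (m := m) (i := 1) (j := 0)
    (F := hfin.toFinset.filter fun n => ¬ |n 1| ≤ |n 0|) hN (by decide)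
    (fun n hn => hfin.mem_toFinset.1 (Finset.mem_filter.1 hn).1)
    (fun n hn => (not_le.1 (Finset.mem_filter.1 hn).2).le)
  have hN' : (1 : ℝ) ≤ N := by exact_mod_cast hN
  have hs : 1 ≤ √(N : ℝ) := Real.one_le_sqrt.2 hN'
  have hf : (⌊30 * √(N : ℝ)⌋₊ : ℝ) ≤ 30 * √(N : ℝ) := Nat.floor_le (by positivity)
  have hpow : (N : ℝ) ^ ((3 : ℝ) / 2) = N * √(N : ℝ) := by
    rw [Real.sqrt_eq_rpow, ← Real.rpow_one_add' (by positivity) (by norm_num)]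
    norm_num
  have hfac : 2 * ((⌊30 * √(N : ℝ)⌋₊ : ℝ) + 1) * (4 * N + 1)
      ≤ 62 * √(N : ℝ) * (5 * N) := by
    exact mul_le_mul (by linarith) (by linarith) (by positivity) (by positivity)
  replace h0 := Nat.cast_le (α := ℝ).2 h0
  replace h1 := Nat.cast_le (α := ℝ).2 h1
  rw [hpow]
  push_cast at h0 h1 ⊢
  linarith

/-- basic counting estimate, elliptic case: there is a universal `C > 0` such
that for all dyadic `A = 2^kA`, `N = 2^kN`, every `a ∈ ℤ²` with `|a| ∼ A`, and every `m ∈ ℤ`,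
`#{n : |n| ∼ N, |⟨a+n⟩ + ⟨n⟩ − m| ≤ 1} ≤ C N^{3/2}`. -/
theorem basic_counting_elliptic :
    ∃ C : ℝ, 0 < C ∧
      ∀ (kA kN : ℕ) (a : Fin 2 → ℤ) (m : ℤ), ann ((2 : ℝ) ^ kA) a →
        (ellSet ((2 : ℝ) ^ kN) a m).Finite ∧
        ((ellSet ((2 : ℝ) ^ kN) a m).ncard : ℝ) ≤
          C * ((2 : ℝ) ^ kN) ^ ((3 : ℝ) / 2) := by
  refine ⟨620, by norm_num, fun _ kN a m _ => ?_⟩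
  have hcast : ((2 : ℝ) ^ kN) = ((2 ^ kN : ℕ) : ℝ) := by push_cast; rfl
  rw [hcast]
  exact ⟨ellSet_finite _ a m, ellSet_ncard_le Nat.one_le_two_pow a m⟩
end

section
/- There exists a universal constant C > 0 with the following property: for all dyadic numbers N, A, B, every a ∈ ℤ² with |a| ∼ A, every sign σ ∈ {−1, 1}, and every m ∈ ℤ, the cardinality of the set { n ∈ ℤ² : |n| ∼ N, |n + a| ∼ B and |⟨a + n⟩ + σ·⟨n⟩ − m| ≤ 1 } is at most C · min(B, N)² / min(A, B, N)^{1/2}. -/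
/-- The counting set of the two-ball counting estimate. -/
def twoBallSet (N B σ : ℝ) (a : Fin 2 → ℤ) (m : ℤ) : Set (Fin 2 → ℤ) :=
  {n | ann N n ∧ ann B (n + a) ∧ |jb (a + n) + σ * jb n - (m : ℝ)| ≤ 1}

lemma sqrt_add_sq_tangent {p R x y : ℝ} (hp : 0 < p) (hx : √(p + x ^ 2) ≤ R)
    (hy : √(p + y ^ 2) ≤ R) :
    y / √(p + y ^ 2) * (x - y) + p / (2 * R ^ 3) * (x - y) ^ 2
      ≤ √(p + x ^ 2) - √(p + y ^ 2) := by
  have hX : 0 < √(p + x ^ 2) := Real.sqrt_pos.2 (by positivity)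
  have hY : 0 < √(p + y ^ 2) := Real.sqrt_pos.2 (by positivity)
  have hX2 : √(p + x ^ 2) ^ 2 = p + x ^ 2 := Real.sq_sqrt (by positivity)
  have hY2 : √(p + y ^ 2) ^ 2 = p + y ^ 2 := Real.sq_sqrt (by positivity)
  set X := √(p + x ^ 2)
  set Y := √(p + y ^ 2)
  have hprod : (X * Y) ^ 2 = (p + x * y) ^ 2 + p * (x - y) ^ 2 := by
    rw [mul_pow, hX2, hY2]; ring
  have hXY : p + x * y ≤ X * Y := by
    refine le_of_sq_le_sq ?_ (by positivity)
    nlinarith [mul_nonneg hp.le (sq_nonneg (x - y))]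
  have key : p * (x - y) ^ 2 ≤ (X * Y - (p + x * y)) * (2 * (X * Y)) := by
    nlinarith [sq_nonneg (X * Y - (p + x * y))]
  have hR : X * Y ^ 2 ≤ R ^ 3 := by
    have hR0 : 0 ≤ R := hX.le.trans hx
    calc X * Y ^ 2 ≤ R * R ^ 2 := by gcongr
      _ = R ^ 3 := by ring
  have h1 : p / (2 * R ^ 3) * (x - y) ^ 2 ≤ p / (2 * (X * Y ^ 2)) * (x - y) ^ 2 := by
    gcongr
  have h2 : p / (2 * (X * Y ^ 2)) * (x - y) ^ 2 ≤ (X * Y - (p + x * y)) / Y := by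
    rw [div_mul_eq_mul_div, div_le_div_iff₀ (by positivity) hY]
    nlinarith [mul_le_mul_of_nonneg_right key hY.le]
  have h3 : (X * Y - (p + x * y)) / Y = X - Y - y / Y * (x - y) := by
    field_simp
    linear_combination hY2
  linarith

lemma sqrt_add_sq_three_point {p R x y z : ℝ} (hp : 0 < p) (hxy : x ≤ y) (hyz : y ≤ z)
    (hx : √(p + x ^ 2) ≤ R) (hy : √(p + y ^ 2) ≤ R) (hz : √(p + z ^ 2) ≤ R) :
    p / (2 * R ^ 3) * ((y - x) * (z - y) * (z - x))
      ≤ (z - y) * (√(p + x ^ 2) - √(p + y ^ 2)) + (y - x) * (√(p + z ^ 2) - √(p + y ^ 2)) := by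
  have h1 := mul_le_mul_of_nonneg_left (sqrt_add_sq_tangent hp hx hy) (sub_nonneg.2 hyz)
  have h2 := mul_le_mul_of_nonneg_left (sqrt_add_sq_tangent hp hz hy) (sub_nonneg.2 hxy)
  refine le_trans (le_of_eq ?_) (add_le_add h1 h2)
  ring

lemma sqrt_add_sq_three_point_nonneg {p x y z : ℝ} (hp : 0 < p) (hxy : x ≤ y) (hyz : y ≤ z) :
    0 ≤ (z - y) * (√(p + x ^ 2) - √(p + y ^ 2))
      + (y - x) * (√(p + z ^ 2) - √(p + y ^ 2)) := by
  have hX := Real.sqrt_nonneg (p + x ^ 2)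
  have hY := Real.sqrt_nonneg (p + y ^ 2)
  have hZ := Real.sqrt_nonneg (p + z ^ 2)
  refine le_trans ?_ (sqrt_add_sq_three_point (R := √(p + x ^ 2) + √(p + y ^ 2) + √(p + z ^ 2))
    hp hxy hyz (by linarith) (by linarith) (by linarith))
  have h1 := sub_nonneg.2 hxy
  have h2 := sub_nonneg.2 hyz
  have h3 := sub_nonneg.2 (hxy.trans hyz)
  positivity

lemma mixed_difference_of_three_point {g : ℝ → ℝ} {q t d b : ℝ} (hd : 0 ≤ d) (hb : 0 < b)
    (h : ∀ y, t ≤ y → y ≤ t + d + b → q * ((y - t) * (t + d + b - y) * (t + d + b - t))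
      ≤ (t + d + b - y) * (g t - g y) + (y - t) * (g (t + d + b) - g y)) :
    2 * q * b * d ≤ (g (t + d + b) - g (t + d)) - (g (t + b) - g t) := by
  have h1 := h (t + d) (by linarith) (by linarith)
  have h2 := h (t + b) (by linarith) (by linarith)
  have h3 : 0 < d + b := by linarith
  refine le_of_mul_le_mul_right ?_ h3
  nlinarith

/-- The difference `√(p + (t + α)²) - √(p + t²)` increases in `t` at a definite rate. -/
lemma sqrt_add_sq_difference_growth {p R α b t d : ℝ} (hp : 0 < p) (hd : 0 ≤ d) (hb : 0 < b)
    (hbα : b ≤ α) (hR : ∀ y, t ≤ y → y ≤ t + d + b → √(p + y ^ 2) ≤ R) :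
    p / R ^ 3 * b * d ≤ (√(p + (t + d + α) ^ 2) - √(p + (t + d) ^ 2))
      - (√(p + (t + α) ^ 2) - √(p + t ^ 2)) := by
  have h1 := mixed_difference_of_three_point (g := fun s ↦ √(p + s ^ 2))
    (q := p / (2 * R ^ 3)) hd hb fun y hy hy' ↦ sqrt_add_sq_three_point hp hy hy'
      (hR _ le_rfl (by linarith)) (hR _ hy hy') (hR _ (by linarith) le_rfl)
  have h2 : √(p + (t + d + b) ^ 2) - √(p + (t + b) ^ 2)
      ≤ √(p + (t + d + α) ^ 2) - √(p + (t + α) ^ 2) := by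
    rcases hbα.eq_or_lt with rfl | hlt
    · rfl
    have := mixed_difference_of_three_point (g := fun s ↦ √(p + s ^ 2)) (q := 0) (t := t + b)
      (b := α - b) hd (by linarith) fun y hy hy' ↦ by
        simpa only [zero_mul] using sqrt_add_sq_three_point_nonneg hp hy hy'
    have e1 : t + b + d + (α - b) = t + d + α := by ring
    have e2 : t + b + d = t + d + b := by ring
    have e3 : t + b + (α - b) = t + α := by ring
    simp only [e1] at this
    simp only [e2, e3] at this
    linarith
  have e : 2 * (p / (2 * R ^ 3)) * b * d = p / R ^ 3 * b * d := by
    rw [mul_div_assoc', mul_div_mul_left _ _ two_ne_zero]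
  simp only [e] at h1
  linarith

lemma abs_sqrt_add_sq_sub_le (r x y : ℝ) (hr : 0 ≤ r) :
    |√(r + x ^ 2) - √(r + y ^ 2)| ≤ |x - y| := by
  wlog h : √(r + y ^ 2) ≤ √(r + x ^ 2) generalizing x y
  · rw [abs_sub_comm, abs_sub_comm x]
    exact this y x (le_of_not_ge h)
  rw [abs_of_nonneg (sub_nonneg.2 h), sub_le_iff_le_add]
  refine Real.sqrt_le_iff.2 ⟨by positivity, ?_⟩
  have h1 : √(r + y ^ 2) ^ 2 = r + y ^ 2 := Real.sq_sqrt (by positivity)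
  have h2 : |y| ≤ √(r + y ^ 2) := Real.abs_le_sqrt (by linarith)
  have h3 : (x - y) * y ≤ |x - y| * |y| := by rw [← abs_mul]; exact le_abs_self _
  nlinarith [sq_abs (x - y), mul_le_mul_of_nonneg_left h2 (abs_nonneg (x - y))]

lemma card_le_of_pairwise_sub_le {s : Finset ℤ} {L : ℝ} (hL : 0 ≤ L)
    (h : ∀ x ∈ s, ∀ y ∈ s, ((y - x : ℤ) : ℝ) ≤ L) : (s.card : ℝ) ≤ L + 1 := by
  rcases s.eq_empty_or_nonempty with rfl | hs
  · simp; linarith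
  have hsub : s ⊆ Finset.Icc (s.min' hs) (s.max' hs) := fun x hx ↦
    Finset.mem_Icc.2 ⟨s.min'_le x hx, s.le_max' x hx⟩
  have hc := Finset.card_le_card hsub
  rw [Int.card_Icc] at hc
  have hm := h _ (s.min'_mem hs) _ (s.max'_mem hs)
  have hle := s.min'_le _ (s.max'_mem hs)
  have : (s.card : ℤ) ≤ s.max' hs - s.min' hs + 1 := by omega
  have : (s.card : ℝ) ≤ ((s.max' hs - s.min' hs : ℤ) : ℝ) + 1 := by exact_mod_cast this
  linarith

lemma card_le_of_triple_product_le {s : Finset ℤ} {D : ℝ} (hD : 0 ≤ D)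
    (h : ∀ x ∈ s, ∀ y ∈ s, ∀ z ∈ s, x ≤ y → y ≤ z →
      ((y - x : ℤ) : ℝ) * ((z - y : ℤ) : ℝ) ≤ D ^ 2) : (s.card : ℝ) ≤ 2 * (D + 1) := by
  rcases s.eq_empty_or_nonempty with rfl | hs
  · simp; linarith
  set x := s.min' hs with hxdef
  set z := s.max' hs with hzdef
  have hx : x ∈ s := s.min'_mem hs
  have hz : z ∈ s := s.max'_mem hs
  have hsub : s ⊆ Finset.Icc x (x + ⌊D⌋) ∪ Finset.Icc (z - ⌊D⌋) z := by
    intro y hy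
    have hxy : x ≤ y := s.min'_le y hy
    have hyz : y ≤ z := s.le_max' y hy
    simp only [Finset.mem_union, Finset.mem_Icc]
    have key : ((y - x : ℤ) : ℝ) ≤ D ∨ ((z - y : ℤ) : ℝ) ≤ D := by
      by_contra! hc
      nlinarith [h x hx y hy z hz hxy hyz, mul_pos (sub_pos.2 hc.1) (sub_pos.2 hc.2)]
    rcases key with k | k
    · have := Int.le_floor.2 k
      left; omega
    · have := Int.le_floor.2 k
      right; omega
  have hc := (Finset.card_le_card hsub).trans (Finset.card_union_le _ _)
  rw [Int.card_Icc, Int.card_Icc] at hc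
  have hf : 0 ≤ ⌊D⌋ := Int.floor_nonneg.2 hD
  have : (s.card : ℤ) ≤ 2 * (⌊D⌋ + 1) := by omega
  have : (s.card : ℝ) ≤ 2 * ((⌊D⌋ : ℝ) + 1) := by exact_mod_cast this
  linarith [Int.floor_le D]

lemma card_le_nine_of_close {s : Finset (Fin 2 → ℤ)}
    (h : ∀ x ∈ s, ∀ y ∈ s, ∀ i, |y i - x i| ≤ 1) : s.card ≤ 9 := by
  rcases s.eq_empty_or_nonempty with rfl | ⟨x, hx⟩
  · simp
  have hsub : s ⊆ Finset.Icc (x - 1) (x + 1) := by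
    intro y hy
    rw [Finset.mem_Icc, Pi.le_def, Pi.le_def]
    refine ⟨fun i ↦ ?_, fun i ↦ ?_⟩ <;>
    · have := abs_le.1 (h x hx y hy i)
      simp only [Pi.sub_apply, Pi.add_apply, Pi.one_apply]
      omega
  refine (Finset.card_le_card hsub).trans ?_
  rw [Pi.card_Icc]
  simp only [Pi.sub_apply, Pi.add_apply, Pi.one_apply, Int.card_Icc, Fin.prod_univ_two]
  have e : ∀ c : ℤ, (c + 1 + 1 - (c - 1)).toNat = 3 := fun c ↦ by omega
  rw [e, e]
  norm_num

lemma card_le_of_rotated_rectangle {s : Finset (Fin 2 → ℤ)} {u v L : ℝ}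
    (huv : u ^ 2 + v ^ 2 = 1) (hL : 0 ≤ L)
    (hh : ∀ x ∈ s, ∀ y ∈ s, |(y 0 * v - y 1 * u) - (x 0 * v - x 1 * u)| ≤ 1)
    (ht : ∀ x ∈ s, ∀ y ∈ s, (y 0 * u + y 1 * v) - (x 0 * u + x 1 * v) ≤ L) :
    (s.card : ℝ) ≤ 9 * (L + 2) := by
  have hfib := Finset.card_le_mul_card_image (f := fun n : Fin 2 → ℤ ↦ ⌊n 0 * u + n 1 * v⌋) s 9
    fun k _ ↦ card_le_nine_of_close fun x hx y hy ↦ by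
      rw [Finset.mem_filter] at hx hy
      have hx1 := Int.floor_eq_iff.1 hx.2
      have hy1 := Int.floor_eq_iff.1 hy.2
      have h1 := (sq_le_one_iff_abs_le_one _).2 (hh x hx.1 y hy.1)
      have h2 : ((y 0 * u + y 1 * v) - (x 0 * u + x 1 * v)) ^ 2 ≤ 1 := by
        rw [sq_le_one_iff_abs_le_one, abs_le]
        constructor <;> linarith
      have h3 : ((y 0 : ℝ) - x 0) ^ 2 + ((y 1 : ℝ) - x 1) ^ 2 ≤ 2 := by
        have : ((y 0 : ℝ) - x 0) ^ 2 + ((y 1 : ℝ) - x 1) ^ 2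
            = ((y 0 * v - y 1 * u) - (x 0 * v - x 1 * u)) ^ 2
              + ((y 0 * u + y 1 * v) - (x 0 * u + x 1 * v)) ^ 2 := by
          linear_combination
            (-(((y 0 : ℝ) - x 0) ^ 2 + ((y 1 : ℝ) - x 1) ^ 2)) * huv
        linarith
      have h4 : (y 0 - x 0) ^ 2 + (y 1 - x 1) ^ 2 ≤ 2 := by exact_mod_cast h3
      intro i
      rw [abs_le]
      fin_cases i <;> simp only [Fin.zero_eta, Fin.mk_one] <;> constructor <;>
        nlinarith [sq_nonneg (y 0 - x 0), sq_nonneg (y 1 - x 1)]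
  have himg := card_le_of_pairwise_sub_le (L := L + 1)
    (s := s.image fun n : Fin 2 → ℤ ↦ ⌊n 0 * u + n 1 * v⌋) (by linarith) (by
      simp only [Finset.forall_mem_image]
      intro x hx y hy
      push_cast
      linarith [ht x hx y hy, Int.floor_le (y 0 * u + y 1 * v),
        Int.lt_floor_add_one (x 0 * u + x 1 * v)])
  have : (s.card : ℝ) ≤ 9 * ((s.image fun n : Fin 2 → ℤ ↦ ⌊n 0 * u + n 1 * v⌋).card : ℝ) := by
    exact_mod_cast hfib
  linarith

lemma card_le_of_rotated_strip {s : Finset (Fin 2 → ℤ)} {u v L : ℝ} {k : ℕ}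
    (huv : u ^ 2 + v ^ 2 = 1) (hL : 0 ≤ L)
    (hh : ∀ x ∈ s, ⌊|x 0 * v - x 1 * u|⌋₊ = k)
    (ht : ∀ x ∈ s, ∀ y ∈ s, (y 0 * u + y 1 * v) - (x 0 * u + x 1 * v) ≤ L) :
    (s.card : ℝ) ≤ 18 * (L + 2) := by
  have hb : ∀ x ∈ s, (k : ℝ) ≤ |x 0 * v - x 1 * u| ∧ |x 0 * v - x 1 * u| < k + 1 :=
    fun x hx ↦ (Nat.floor_eq_iff (abs_nonneg _)).1 (hh x hx)
  have h1 := card_le_of_rotated_rectangle (s := s.filter fun x ↦ 0 ≤ x 0 * v - x 1 * u)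
    huv hL (fun x hx y hy ↦ by
      rw [Finset.mem_filter] at hx hy
      have hx1 := hb x hx.1
      have hy1 := hb y hy.1
      rw [abs_of_nonneg hx.2] at hx1
      rw [abs_of_nonneg hy.2] at hy1
      rw [abs_le]
      constructor <;> linarith)
    fun x hx y hy ↦ ht x (Finset.mem_filter.1 hx).1 y (Finset.mem_filter.1 hy).1
  have h2 := card_le_of_rotated_rectangle (s := s.filter fun x ↦ ¬ 0 ≤ x 0 * v - x 1 * u)
    huv hL (fun x hx y hy ↦ by
      rw [Finset.mem_filter] at hx hy
      have hx1 := hb x hx.1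
      have hy1 := hb y hy.1
      rw [abs_of_neg (not_le.1 hx.2)] at hx1
      rw [abs_of_neg (not_le.1 hy.2)] at hy1
      rw [abs_le]
      constructor <;> linarith)
    fun x hx y hy ↦ ht x (Finset.mem_filter.1 hx).1 y (Finset.mem_filter.1 hy).1
  rw [← Finset.card_filter_add_card_filter_not (s := s) (fun x ↦ 0 ≤ x 0 * v - x 1 * u)]
  push_cast
  linarith

lemma sum_row_bounds_le {c : ℕ → ℝ} {N Q : ℝ} {K : ℕ} (hN : 1 ≤ N) (hQ : 1 ≤ Q)
    (hK : (K : ℝ) ≤ 2 * N) (hc : ∀ k, 0 ≤ c k) (h1 : ∀ k, c k ≤ 18 * (4 * N + 2))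
    (h2 : ∀ k, 1 ≤ k → c k ≤ 18 * (512 * N * Q ^ 2 * ((k : ℝ) ^ 2)⁻¹ + 2)) :
    ∑ k ∈ Finset.range (K + 1), c k ≤ 20000 * (N * Q) := by
  have hk1 : 1 ≤ ⌊Q⌋₊ := Nat.one_le_floor_iff Q |>.2 hQ
  have hkQ : (⌊Q⌋₊ : ℝ) ≤ Q := Nat.floor_le (by linarith)
  have hkQ' : Q < ⌊Q⌋₊ + 1 := Nat.lt_floor_add_one Q
  set k₀ := ⌊Q⌋₊
  have hk1' : (1 : ℝ) ≤ k₀ := by exact_mod_cast hk1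
  have hsub : Finset.range (K + 1) ⊆ Finset.range (k₀ + 1) ∪ Finset.Ioc k₀ (k₀ + K) := by
    intro k hk
    simp only [Finset.mem_union, Finset.mem_range, Finset.mem_Ioc] at hk ⊢
    omega
  have hdisj : Disjoint (Finset.range (k₀ + 1)) (Finset.Ioc k₀ (k₀ + K)) := by
    rw [Finset.disjoint_left]
    intro k hk
    simp only [Finset.mem_range, Finset.mem_Ioc] at hk ⊢
    omega
  have hlow : ∑ k ∈ Finset.range (k₀ + 1), c k ≤ (k₀ + 1) * (18 * (4 * N + 2)) := by
    have := Finset.sum_le_card_nsmul (Finset.range (k₀ + 1)) c _ fun k _ ↦ h1 k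
    rw [Finset.card_range, nsmul_eq_mul] at this
    exact_mod_cast this
  have hinv : ∑ k ∈ Finset.Ioc k₀ (k₀ + K), ((k : ℝ) ^ 2)⁻¹ ≤ 2 / Q := by
    have h3 := sum_Ioc_inv_sq_le_sub (α := ℝ) (k := k₀) (n := k₀ + K) (by omega) (by omega)
    have h4 : (0 : ℝ) ≤ ((k₀ + K : ℕ) : ℝ)⁻¹ := by positivity
    have h5 : (k₀ : ℝ)⁻¹ ≤ 2 / Q := by
      rw [inv_eq_one_div, div_le_div_iff₀ (by linarith) (by linarith)]
      linarith
    linarith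
  have hhigh : ∑ k ∈ Finset.Ioc k₀ (k₀ + K), c k ≤ 18 * (512 * N * Q ^ 2 * (2 / Q)) + 36 * K := by
    calc ∑ k ∈ Finset.Ioc k₀ (k₀ + K), c k
        ≤ ∑ k ∈ Finset.Ioc k₀ (k₀ + K), (18 * (512 * N * Q ^ 2 * ((k : ℝ) ^ 2)⁻¹) + 36) := by
          refine Finset.sum_le_sum fun k hk ↦ ?_
          have := h2 k (by have := Finset.mem_Ioc.1 hk; omega)
          linarith
      _ = 18 * (512 * N * Q ^ 2 * ∑ k ∈ Finset.Ioc k₀ (k₀ + K), ((k : ℝ) ^ 2)⁻¹) + 36 * K := by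
          rw [Finset.sum_add_distrib, ← Finset.mul_sum, ← Finset.mul_sum, Finset.sum_const,
            Nat.card_Ioc, nsmul_eq_mul, Nat.add_sub_cancel_left]
          ring
      _ ≤ _ := by gcongr
  have hQ2 : 18 * (512 * N * Q ^ 2 * (2 / Q)) = 18432 * (N * Q) := by
    field_simp
    norm_num
  calc ∑ k ∈ Finset.range (K + 1), c k
      ≤ ∑ k ∈ Finset.range (k₀ + 1) ∪ Finset.Ioc k₀ (k₀ + K), c k :=
        Finset.sum_le_sum_of_subset_of_nonneg hsub fun k _ _ ↦ hc k
    _ = ∑ k ∈ Finset.range (k₀ + 1), c k + ∑ k ∈ Finset.Ioc k₀ (k₀ + K), c k :=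
        Finset.sum_union hdisj
    _ ≤ 20000 * (N * Q) := by
        nlinarith [mul_le_mul_of_nonneg_left hkQ (by linarith : (0 : ℝ) ≤ N),
          mul_le_mul_of_nonneg_left hQ (by linarith : (0 : ℝ) ≤ N)]

/-- Level sets of `n ↦ ⟨a + n⟩ - ⟨n⟩` in a ball. -/
lemma card_difference_level_le {s : Finset (Fin 2 → ℤ)} {a : Fin 2 → ℤ} {N M : ℝ}
    (hN : 1 ≤ N) (hM : 0 < M) (hMN : M ≤ N) (hMa : M ≤ 2 * znorm a)
    (hs : ∀ x ∈ s, znorm x ≤ 2 * N)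
    (hf : ∀ x ∈ s, ∀ y ∈ s, (jb (a + y) - jb y) - (jb (a + x) - jb x) ≤ 2) :
    (s.card : ℝ) ≤ 20000 * (N * (N / √M)) := by
  have hα : 0 < znorm a := by linarith
  have ha2 := znorm_sq a
  set α := znorm a
  obtain ⟨u, hu⟩ : ∃ u : ℝ, α * u = a 0 := ⟨a 0 / α, by field_simp⟩
  obtain ⟨v, hv⟩ : ∃ v : ℝ, α * v = a 1 := ⟨a 1 / α, by field_simp⟩
  have huv : u ^ 2 + v ^ 2 = 1 := by
    have : α ^ 2 * (u ^ 2 + v ^ 2) = α ^ 2 * 1 := by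
      rw [← hu, ← hv] at ha2
      linarith
    exact mul_left_cancel₀ (by positivity) this
  let h : (Fin 2 → ℤ) → ℝ := fun x ↦ x 0 * v - x 1 * u
  let t : (Fin 2 → ℤ) → ℝ := fun x ↦ x 0 * u + x 1 * v
  have hht : ∀ x, h x ^ 2 + t x ^ 2 = znorm x ^ 2 := fun x ↦ by
    rw [znorm_sq]
    simp only [h, t]
    linear_combination ((x 0 : ℝ) ^ 2 + (x 1 : ℝ) ^ 2) * huv
  have hball : ∀ x ∈ s, h x ^ 2 + t x ^ 2 ≤ (2 * N) ^ 2 := fun x hx ↦ by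
    rw [hht]
    exact pow_le_pow_left₀ (znorm_nonneg x) (hs x hx) 2
  have htN : ∀ x ∈ s, |t x| ≤ 2 * N := fun x hx ↦
    abs_le_of_sq_le_sq (by nlinarith [hball x hx, sq_nonneg (h x)]) (by linarith)
  have hhN : ∀ x ∈ s, |h x| ≤ 2 * N := fun x hx ↦
    abs_le_of_sq_le_sq (by nlinarith [hball x hx, sq_nonneg (t x)]) (by linarith)
  have hjb : ∀ x, jb x = √(1 + h x ^ 2 + t x ^ 2) := fun x ↦ by
    rw [add_assoc, hht, znorm_sq, jb, add_assoc]
  have hjba : ∀ x, jb (a + x) = √(1 + h x ^ 2 + (t x + α) ^ 2) := fun x ↦ by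
    rw [jb]
    congr 1
    simp only [Pi.add_apply, Int.cast_add, ← hu, ← hv, h, t]
    linear_combination (α ^ 2 - (x 0 : ℝ) ^ 2 - (x 1 : ℝ) ^ 2) * huv
  have hlip : ∀ x y r : ℝ, |(|x| - |y|)| ≤ 1 →
      |√(1 + x ^ 2 + r ^ 2) - √(1 + y ^ 2 + r ^ 2)| ≤ 1 := fun x y r hxy ↦ by
    have := abs_sqrt_add_sq_sub_le (1 + r ^ 2) |x| |y| (by positivity)
    rw [sq_abs, sq_abs, add_right_comm, add_right_comm 1 (r ^ 2)] at this
    exact this.trans hxy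
  have hQ : 1 ≤ N / √M := by
    rw [one_le_div (Real.sqrt_pos.2 hM)]
    refine Real.sqrt_le_iff.2 ⟨by linarith, by nlinarith⟩
  have hQ2 : (N / √M) ^ 2 = N ^ 2 / M := by rw [div_pow, Real.sq_sqrt hM.le]
  have hrow : ∀ k : ℕ, ∀ x ∈ s, ⌊|h x|⌋₊ = k → ∀ y ∈ s, ⌊|h y|⌋₊ = k →
      (1 + h x ^ 2) * (t y - t x) ≤ 512 * N * (N / √M) ^ 2 := by
    intro k x hx hxk y hy hyk
    have hx1 := (Nat.floor_eq_iff (abs_nonneg _)).1 hxk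
    have hy1 := (Nat.floor_eq_iff (abs_nonneg _)).1 hyk
    rcases le_total (t y) (t x) with hle | hle
    · have h1 : (1 + h x ^ 2) * (t y - t x) ≤ 0 :=
        mul_nonpos_of_nonneg_of_nonpos (by positivity) (by linarith)
      have h2 : 0 ≤ 512 * N * (N / √M) ^ 2 := by positivity
      linarith
    have htx := abs_le.1 (htN x hx)
    have hty := abs_le.1 (htN y hy)
    have hgrow := sqrt_add_sq_difference_growth (p := 1 + h x ^ 2) (R := 4 * N) (α := α)
      (b := M / 2) (t := t x) (d := t y - t x) (by positivity) (sub_nonneg.2 hle)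
      (by linarith) (by linarith) (fun z hz hz' ↦ by
        have hz1 : z ^ 2 ≤ (5 / 2 * N) ^ 2 := sq_le_sq' (by linarith) (by linarith)
        have := hball x hx
        refine Real.sqrt_le_iff.2 ⟨by linarith, ?_⟩
        nlinarith [sq_nonneg (t x)])
    rw [add_sub_cancel, ← hjb, ← hjba] at hgrow
    have hxy : |(|h x| - |h y|)| ≤ 1 := by rw [abs_le]; constructor <;> linarith
    have h1 := abs_le.1 (hlip _ _ (t y) hxy)
    have h2 := abs_le.1 (hlip _ _ (t y + α) hxy)
    have h3 := hf x hx y hy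
    rw [hjb y, hjba y] at h3
    have h4 : (1 + h x ^ 2) / (4 * N) ^ 3 * (M / 2) * (t y - t x) ≤ 4 := by linarith
    rw [hQ2]
    have h5 : (1 + h x ^ 2) / (4 * N) ^ 3 * (M / 2) * (t y - t x)
        = ((1 + h x ^ 2) * (t y - t x)) / (128 * N ^ 3 / M) := by
      field_simp
      norm_num
      ring
    rw [h5, div_le_iff₀ (by positivity)] at h4
    refine h4.trans (le_of_eq ?_)
    field_simp
    norm_num
  have hmaps : Set.MapsTo (fun x ↦ ⌊|h x|⌋₊) (s : Set (Fin 2 → ℤ))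
      (Finset.range (⌊2 * N⌋₊ + 1) : Finset ℕ) := fun x hx ↦ by
    simp only [Finset.coe_range, Set.mem_Iio, Nat.lt_succ_iff]
    exact Nat.floor_le_floor (hhN x hx)
  rw [Finset.card_eq_sum_card_fiberwise hmaps]
  push_cast
  refine sum_row_bounds_le hN hQ (Nat.floor_le (by linarith)) (fun k ↦ by positivity)
    (fun k ↦ ?_) fun k hk ↦ ?_
  · refine card_le_of_rotated_strip (k := k) huv (by linarith)
      (fun x hx ↦ (Finset.mem_filter.1 hx).2) fun x hx y hy ↦ ?_
    have htx := abs_le.1 (htN x (Finset.mem_filter.1 hx).1)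
    have hty := abs_le.1 (htN y (Finset.mem_filter.1 hy).1)
    change t y - t x ≤ _
    linarith
  · refine card_le_of_rotated_strip (k := k) huv (by positivity)
      (fun x hx ↦ (Finset.mem_filter.1 hx).2) fun x hx y hy ↦ ?_
    rw [Finset.mem_filter] at hx hy
    have hx1 := (Nat.floor_eq_iff (abs_nonneg _)).1 hx.2
    have hrow := hrow k x hx.1 hx.2 y hy.1 hy.2
    change t y - t x ≤ _
    have hk0 : (0 : ℝ) < k := by exact_mod_cast hk
    rw [← div_eq_mul_inv, le_div_iff₀ (by positivity)]
    have h6 : (k : ℝ) ^ 2 ≤ 1 + h x ^ 2 := by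
      have := pow_le_pow_left₀ hk0.le hx1.1 2
      rw [sq_abs] at this
      linarith
    rcases le_total (t y) (t x) with hle | hle
    · have h1 : (t y - t x) * (k : ℝ) ^ 2 ≤ 0 :=
        mul_nonpos_of_nonpos_of_nonneg (by linarith) (by positivity)
      have h2 : 0 ≤ 512 * N * (N / √M) ^ 2 := by positivity
      linarith
    · nlinarith [mul_le_mul_of_nonneg_right h6 (sub_nonneg.2 hle)]

/-- Level sets of `n ↦ ⟨a + n⟩ + ⟨n⟩` in a ball, where one coordinate is large. -/
lemma card_sum_level_le_of_coord {s : Finset (Fin 2 → ℤ)} {a : Fin 2 → ℤ} {N : ℝ} {i j : Fin 2}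
    (hij : i ≠ j) (hN : 1 ≤ N) (hs : ∀ x ∈ s, znorm x ≤ 2 * N)
    (hi : ∀ x ∈ s, (N / 4) ^ 2 ≤ (x i : ℝ) ^ 2)
    (hf : ∀ x ∈ s, ∀ y ∈ s, (jb (a + y) + jb y) - (jb (a + x) + jb x) ≤ 2) :
    (s.card : ℝ) ≤ 430 * (N * √N) := by
  have hsum : ∀ x : Fin 2 → ℤ, (x 0 : ℝ) ^ 2 + (x 1 : ℝ) ^ 2 = (x i : ℝ) ^ 2 + (x j : ℝ) ^ 2 := by
    intro x
    fin_cases i <;> fin_cases j <;> simp_all [add_comm]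
  have hjb : ∀ x, jb x = √(1 + (x i : ℝ) ^ 2 + (x j : ℝ) ^ 2) := fun x ↦ by
    rw [jb, add_assoc, hsum, add_assoc]
  have hball : ∀ x ∈ s, (x i : ℝ) ^ 2 + (x j : ℝ) ^ 2 ≤ (2 * N) ^ 2 := fun x hx ↦ by
    rw [← hsum, ← znorm_sq]
    exact pow_le_pow_left₀ (znorm_nonneg x) (hs x hx) 2
  have hR : ∀ x ∈ s, jb x ≤ 3 * N := fun x hx ↦ by
    rw [hjb]
    refine Real.sqrt_le_iff.2 ⟨by linarith, ?_⟩
    nlinarith [hball x hx]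
  have hN1 : 1 ≤ √N := Real.one_le_sqrt.2 hN
  have hN2 : √N ^ 2 = N := Real.sq_sqrt (by linarith)
  have hmaps : Set.MapsTo (fun x : Fin 2 → ℤ ↦ x i) (s : Set (Fin 2 → ℤ))
      (Finset.Icc (-⌊2 * N⌋) ⌊2 * N⌋ : Finset ℤ) := fun x hx ↦ by
    have h1 : |(x i : ℝ)| ≤ 2 * N :=
      abs_le_of_sq_le_sq (by nlinarith [hball x hx, sq_nonneg (x j : ℝ)]) (by linarith)
    have h2 : |x i| ≤ ⌊2 * N⌋ := Int.le_floor.2 (by exact_mod_cast h1)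
    rw [Finset.coe_Icc, Set.mem_Icc]
    exact abs_le.1 h2
  have hfib : ∀ k : ℤ, ((s.filter fun x ↦ x i = k).card : ℝ) ≤ 86 * √N := by
    intro k
    have hinj : Set.InjOn (fun x : Fin 2 → ℤ ↦ x j) (s.filter fun x ↦ x i = k) := by
      intro x hx y hy hxy
      simp only [Finset.coe_filter, Set.mem_ofPred_eq] at hx hy hxy
      ext l
      have hl : l = i ∨ l = j := by omega
      rcases hl with rfl | rfl
      · rw [hx.2, hy.2]
      · exact hxy
    rw [← Finset.card_image_of_injOn hinj]
    refine (card_le_of_triple_product_le (D := 42 * √N) (by positivity) ?_).trans (by linarith)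
    simp only [Finset.forall_mem_image, Finset.mem_filter]
    rintro x ⟨hx, hxk⟩ y ⟨hy, hyk⟩ z ⟨hz, hzk⟩ hxy hyz
    have hxy' : (x j : ℝ) ≤ y j := by exact_mod_cast hxy
    have hyz' : (y j : ℝ) ≤ z j := by exact_mod_cast hyz
    rw [mul_pow, hN2]
    push_cast
    rcases (hxy'.trans hyz').eq_or_lt with heq | hlt
    · have : (y j : ℝ) = x j := by linarith
      rw [this, sub_self, zero_mul]
      positivity
    have hxR := hR x hx
    have hyR := hR y hy
    have hzR := hR z hz
    have hk := hi x hx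
    have hxy2 := hf y hy x hx
    have hzy2 := hf y hy z hz
    simp only [hjb, Pi.add_apply, Int.cast_add, hxk, hyk, hzk] at hxR hyR hzR hk hxy2 hzy2
    have h1 := sqrt_add_sq_three_point (p := 1 + (k : ℝ) ^ 2) (by positivity) hxy' hyz' hxR hyR hzR
    have h2 := sqrt_add_sq_three_point_nonneg (p := 1 + ((a i : ℝ) + k) ^ 2) (by positivity)
      (add_le_add_right hxy' (a j : ℝ)) (add_le_add_right hyz' (a j : ℝ))
    rw [add_sub_add_left_eq_sub, add_sub_add_left_eq_sub] at h2
    have h3 := mul_le_mul_of_nonneg_left hxy2 (sub_nonneg.2 hyz')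
    have h4 := mul_le_mul_of_nonneg_left hzy2 (sub_nonneg.2 hxy')
    have h5 : (1 + (k : ℝ) ^ 2) / (2 * (3 * N) ^ 3) * (((y j : ℝ) - x j) * (z j - y j)) ≤ 2 := by
      refine le_of_mul_le_mul_right ?_ (sub_pos.2 hlt)
      linarith
    have h6 : 1 / (864 * N) ≤ (1 + (k : ℝ) ^ 2) / (2 * (3 * N) ^ 3) := by
      rw [div_le_div_iff₀ (by positivity) (by positivity)]
      nlinarith [mul_le_mul_of_nonneg_right hk (by linarith : (0 : ℝ) ≤ N)]
    have h7 := mul_le_mul_of_nonneg_right h6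
      (mul_nonneg (sub_nonneg.2 hxy') (sub_nonneg.2 hyz'))
    have h8 := h7.trans h5
    rw [div_mul_eq_mul_div, one_mul, div_le_iff₀ (by positivity)] at h8
    linarith
  rw [Finset.card_eq_sum_card_fiberwise hmaps]
  push_cast
  refine (Finset.sum_le_card_nsmul _ _ _ fun k _ ↦ hfib k).trans ?_
  have hfl : 0 ≤ ⌊2 * N⌋ := Int.floor_nonneg.2 (by linarith)
  have hcard : ((Finset.Icc (-⌊2 * N⌋) ⌊2 * N⌋).card : ℤ) = 2 * ⌊2 * N⌋ + 1 := by
    rw [Int.card_Icc]; omega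
  have hcard' : ((Finset.Icc (-⌊2 * N⌋) ⌊2 * N⌋).card : ℝ) = 2 * (⌊2 * N⌋ : ℝ) + 1 := by
    exact_mod_cast hcard
  rw [nsmul_eq_mul, hcard']
  nlinarith [Int.floor_le (2 * N)]

lemma card_sum_level_le {s : Finset (Fin 2 → ℤ)} {a : Fin 2 → ℤ} {N : ℝ} (hN : 1 ≤ N)
    (hs : ∀ x ∈ s, ann N x)
    (hf : ∀ x ∈ s, ∀ y ∈ s, (jb (a + y) + jb y) - (jb (a + x) + jb x) ≤ 2) :
    (s.card : ℝ) ≤ 860 * (N * √N) := by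
  have h0 := card_sum_level_le_of_coord (s := s.filter fun x ↦ (N / 4) ^ 2 ≤ (x 0 : ℝ) ^ 2)
    (a := a) (i := 0) (j := 1) (by decide) hN
    (fun x hx ↦ (hs x (Finset.mem_filter.1 hx).1).2) (fun x hx ↦ (Finset.mem_filter.1 hx).2)
    fun x hx y hy ↦ hf x (Finset.mem_filter.1 hx).1 y (Finset.mem_filter.1 hy).1
  have h1 := card_sum_level_le_of_coord (s := s.filter fun x ↦ ¬ (N / 4) ^ 2 ≤ (x 0 : ℝ) ^ 2)
    (a := a) (i := 1) (j := 0) (by decide) hN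
    (fun x hx ↦ (hs x (Finset.mem_filter.1 hx).1).2) (fun x hx ↦ by
      rw [Finset.mem_filter, not_le] at hx
      have := pow_le_pow_left₀ (by linarith) (hs x hx.1).1 2
      rw [znorm_sq] at this
      nlinarith [hx.2])
    fun x hx y hy ↦ hf x (Finset.mem_filter.1 hx).1 y (Finset.mem_filter.1 hy).1
  rw [← Finset.card_filter_add_card_filter_not (s := s) fun x ↦ (N / 4) ^ 2 ≤ (x 0 : ℝ) ^ 2]
  push_cast
  linarith

lemma finite_twoBallSet (N B σ : ℝ) (a : Fin 2 → ℤ) (m : ℤ) : (twoBallSet N B σ a m).Finite := by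
  refine (Set.finite_Icc (fun _ ↦ -⌊2 * N⌋ : Fin 2 → ℤ) fun _ ↦ ⌊2 * N⌋).subset ?_
  intro x hx
  have h : ∀ i, |x i| ≤ ⌊2 * N⌋ := fun i ↦ by
    refine Int.le_floor.2 (le_trans ?_ hx.1.2)
    rw [Int.cast_abs]
    refine Real.abs_le_sqrt ?_
    fin_cases i
    · exact le_add_of_nonneg_right (sq_nonneg _)
    · exact le_add_of_nonneg_left (sq_nonneg _)
  exact ⟨fun i ↦ (abs_le.1 (h i)).1, fun i ↦ (abs_le.1 (h i)).2⟩

lemma ncard_twoBallSet_le {N A B σ : ℝ} {a : Fin 2 → ℤ} (hN : 1 ≤ N) (hA : 1 ≤ A)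
    (hσ : σ = -1 ∨ σ = 1) (m : ℤ) (ha : ann A a) :
    ((twoBallSet N B σ a m).ncard : ℝ) ≤ 20000 * N ^ 2 / √(min A N) := by
  rw [Set.ncard_eq_toFinset_card _ (finite_twoBallSet N B σ a m)]
  set s := (finite_twoBallSet N B σ a m).toFinset with hs
  have hmem : ∀ x ∈ s, x ∈ twoBallSet N B σ a m := fun x hx ↦ by simpa [hs] using hx
  have hM : 0 < min A N := by positivity
  have e : 20000 * N ^ 2 / √(min A N) = 20000 * (N * (N / √(min A N))) := by ring
  rw [e]
  rcases hσ with rfl | rfl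
  · refine card_difference_level_le (a := a) hN hM (min_le_right _ _)
      (by linarith [min_le_left A N, ha.1]) (fun x hx ↦ (hmem x hx).1.2) fun x hx y hy ↦ ?_
    linarith [(abs_le.1 (hmem x hx).2.2).1, (abs_le.1 (hmem y hy).2.2).2]
  · have h1 := card_sum_level_le (a := a) hN (fun x hx ↦ (hmem x hx).1) fun x hx y hy ↦ by
      linarith [(abs_le.1 (hmem x hx).2.2).1, (abs_le.1 (hmem y hy).2.2).2]
    have h2 : √N ≤ N / √(min A N) := by
      rw [le_div_iff₀ (Real.sqrt_pos.2 hM)]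
      calc √N * √(min A N) ≤ √N * √N := by gcongr; exact min_le_right _ _
        _ = N := Real.mul_self_sqrt (by linarith)
    have h3 : N * √N ≤ N * (N / √(min A N)) := by gcongr
    have h4 : 0 ≤ N * √N := by positivity
    linarith

lemma znorm_neg (x : Fin 2 → ℤ) : znorm (-x) = znorm x := by simp [znorm]

lemma jb_neg (x : Fin 2 → ℤ) : jb (-x) = jb x := by simp [jb]

lemma ncard_twoBallSet_le_swap {N B σ : ℝ} (a : Fin 2 → ℤ) (hσ : σ = -1 ∨ σ = 1) (m : ℤ) :
    ∃ m' : ℤ, (twoBallSet N B σ a m).ncard ≤ (twoBallSet B N σ a m').ncard := by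
  obtain ⟨m', hm'⟩ : ∃ m' : ℤ, (m' : ℝ) = σ * m := by
    rcases hσ with rfl | rfl
    · exact ⟨-m, by push_cast; ring⟩
    · exact ⟨m, by ring⟩
  refine ⟨m', Set.ncard_le_ncard_of_injOn (fun n ↦ -(n + a)) ?_ ?_ (finite_twoBallSet _ _ _ _ _)⟩
  · rintro n ⟨h1, h2, h3⟩
    have e1 : -(n + a) + a = -n := by abel
    have e2 : a + -(n + a) = -n := by abel
    refine ⟨by rwa [ann, znorm_neg], by rwa [e1, ann, znorm_neg], ?_⟩
    rw [e2, jb_neg, jb_neg, hm', add_comm n a]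
    have hσ1 : |σ| = 1 := by rcases hσ with rfl | rfl <;> simp
    have hσ2 : σ * σ = 1 := by rcases hσ with rfl | rfl <;> norm_num
    have e3 : jb n + σ * jb (a + n) - σ * m = σ * (jb (a + n) + σ * jb n - m) := by
      linear_combination -jb n * hσ2
    rw [e3, abs_mul, hσ1, one_mul]
    exact h3
  · intro x _ y _ hxy
    exact add_right_cancel (neg_injective hxy)

/-- two-ball counting estimate: there is a universal `C > 0` such that for all
dyadic `N, A, B`, every `a ∈ ℤ²` with `|a| ∼ A`, every sign `σ ∈ {−1,1}` and every `m ∈ ℤ`,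
`#{n : |n| ∼ N, |n+a| ∼ B, |⟨a+n⟩ + σ⟨n⟩ − m| ≤ 1} ≤ C min(B,N)² / min(A,B,N)^{1/2}`. -/
theorem two_ball_counting :
    ∃ C : ℝ, 0 < C ∧
      ∀ (kN kA kB : ℕ) (a : Fin 2 → ℤ) (σ : ℝ), (σ = -1 ∨ σ = 1) →
        ∀ m : ℤ, ann ((2 : ℝ) ^ kA) a →
          (twoBallSet ((2 : ℝ) ^ kN) ((2 : ℝ) ^ kB) σ a m).Finite ∧
          ((twoBallSet ((2 : ℝ) ^ kN) ((2 : ℝ) ^ kB) σ a m).ncard : ℝ) ≤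
            C * (min ((2 : ℝ) ^ kB) ((2 : ℝ) ^ kN)) ^ 2 /
              Real.sqrt (min ((2 : ℝ) ^ kA) (min ((2 : ℝ) ^ kB) ((2 : ℝ) ^ kN))) := by
  refine ⟨20000, by norm_num, fun kN kA kB a σ hσ m ha ↦ ⟨finite_twoBallSet _ _ _ _ _, ?_⟩⟩
  have hN : (1 : ℝ) ≤ 2 ^ kN := one_le_pow₀ one_le_two
  have hA : (1 : ℝ) ≤ 2 ^ kA := one_le_pow₀ one_le_two
  have hB : (1 : ℝ) ≤ 2 ^ kB := one_le_pow₀ one_le_two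
  rcases le_total ((2 : ℝ) ^ kN) (2 ^ kB) with h | h
  · rw [min_eq_right h]
    exact ncard_twoBallSet_le hN hA hσ m ha
  · rw [min_eq_left h]
    obtain ⟨m', hm'⟩ := ncard_twoBallSet_le_swap (N := 2 ^ kN) (B := 2 ^ kB) a hσ m
    exact le_trans (by exact_mod_cast hm') (ncard_twoBallSet_le (B := 2 ^ kN) hB hA hσ m' ha)
end

section
/- There exists a universal constant C > 0 with the following property: for all signs σ, σ₁, σ₂, σ₃ ∈ {−1, 1}, all dyadic numbers N₁, N₂, N₃, and every m ∈ ℤ, the cardinality of the set { (n₁, n₂, n₃) ∈ (ℤ²)³ : |n_j| ∼ N_j for j = 1, 2, 3 and |φ(n₁,n₂,n₃) − m| ≤ 1 } is at most C · (N₁ · N₂ · N₃)² / med(N₁, N₂, N₃)^{1/2}. -/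
/-- The cubic phase function `φ(n₁,n₂,n₃) = σ⟨n₁+n₂+n₃⟩ + σ₁⟨n₁⟩ + σ₂⟨n₂⟩ + σ₃⟨n₃⟩`. -/
noncomputable def phase (σ σ₁ σ₂ σ₃ : ℝ) (n₁ n₂ n₃ : Fin 2 → ℤ) : ℝ :=
  σ * jb (n₁ + n₂ + n₃) + σ₁ * jb n₁ + σ₂ * jb n₂ + σ₃ * jb n₃

/-- The median (middle value) of three real numbers. -/
noncomputable def med3 (a b c : ℝ) : ℝ :=
  max (min a b) (min (max a b) c)

/-- The counting set of the cubic counting estimate (i). -/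
def cubicSet (σ σ₁ σ₂ σ₃ N₁ N₂ N₃ : ℝ) (m : ℤ) : Set (Fin 3 → Fin 2 → ℤ) :=
  {v | ann N₁ (v 0) ∧ ann N₂ (v 1) ∧ ann N₃ (v 2) ∧
    |phase σ σ₁ σ₂ σ₃ (v 0) (v 1) (v 2) - (m : ℝ)| ≤ 1}

open Finset in
/-- If an integer-valued `f` has oscillation at most `L` on `s` and all its fibres have at most `r`
elements, then `s` has at most `(L + 1) * r` elements. -/
theorem card_le_of_fibers {α : Type*} (s : Finset α) (f : α → ℤ) {L r : ℝ} (hL : 0 ≤ L)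
    (hr : 0 ≤ r) (hf : ∀ v ∈ s, ∀ w ∈ s, (f v : ℝ) - f w ≤ L)
    (hfib : ∀ k, ((s.filter fun v => f v = k).card : ℝ) ≤ r) : (s.card : ℝ) ≤ (L + 1) * r := by
  rcases s.eq_empty_or_nonempty with rfl | hs
  · simpa using by positivity
  obtain ⟨w, hw, hmin⟩ := s.exists_min_image f hs
  have hmaps : ∀ v ∈ s, f v ∈ Icc (f w) (f w + ⌊L⌋) := fun v hv => by
    have : f v - f w ≤ ⌊L⌋ := Int.le_floor.2 (by push_cast; exact hf v hv w hw)
    exact mem_Icc.2 ⟨hmin v hv, by linarith⟩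
  have hfl : 0 ≤ ⌊L⌋ := Int.floor_nonneg.2 hL
  have hcard : ((Icc (f w) (f w + ⌊L⌋)).card : ℝ) ≤ L + 1 := by
    have h1 : ((Icc (f w) (f w + ⌊L⌋)).card : ℤ) = ⌊L⌋ + 1 := by
      rw [Int.card_Icc, Int.toNat_of_nonneg (by linarith)]; ring
    have h2 : ((Icc (f w) (f w + ⌊L⌋)).card : ℝ) = ⌊L⌋ + 1 := by exact_mod_cast h1
    rw [h2]; linarith [Int.floor_le L]
  rw [card_eq_sum_card_fiberwise hmaps]
  push_cast
  calc _ ≤ ∑ _k ∈ Icc (f w) (f w + ⌊L⌋), r := sum_le_sum fun k _ => hfib k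
    _ = (Icc (f w) (f w + ⌊L⌋)).card * r := by simp
    _ ≤ _ := by gcongr

theorem card_le_of_injOn {α : Type*} (s : Finset α) (f : α → ℤ) {L : ℝ} (hL : 0 ≤ L)
    (hf : ∀ v ∈ s, ∀ w ∈ s, (f v : ℝ) - f w ≤ L)
    (hinj : ∀ v ∈ s, ∀ w ∈ s, f v = f w → v = w) : (s.card : ℝ) ≤ L + 1 := by
  have := card_le_of_fibers s f hL zero_le_one hf fun k => by
    rw [Nat.cast_le_one, Finset.card_le_one]
    intro v hv w hw
    rw [Finset.mem_filter] at hv hw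
    exact hinj v hv.1 w hw.1 (hv.2.trans hw.2.symm)
  simpa using this

theorem sum_inv_sqrt_le (n : ℕ) :
    ∑ k ∈ Finset.range (n + 1), 1 / √(max 1 (k : ℝ)) ≤ 1 + 2 * √n := by
  induction n with
  | zero => simp
  | succ n ih =>
    rw [Finset.sum_range_succ]
    have h1 : max 1 ((n + 1 : ℕ) : ℝ) = n + 1 := by
      push_cast; exact max_eq_right (by linarith [Nat.cast_nonneg (α := ℝ) n])
    rw [h1]
    have hn : (0 : ℝ) ≤ n := Nat.cast_nonneg n
    have hpos : 0 < √((n : ℝ) + 1) := Real.sqrt_pos.2 (by linarith)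
    have hs := Real.sq_sqrt (show (0 : ℝ) ≤ n + 1 by linarith)
    have hs' := Real.sq_sqrt hn
    have h2 : 1 / √((n : ℝ) + 1) ≤ 2 * √((n : ℝ) + 1) - 2 * √(n : ℝ) := by
      rw [div_le_iff₀ hpos]
      nlinarith [sq_nonneg (√((n : ℝ) + 1) - √(n : ℝ))]
    push_cast
    linarith

open Finset in
theorem card_le_of_weighted_fibers {α : Type*} (s : Finset α) (f : α → ℤ) {K B : ℝ} (hK : 1 ≤ K)
    (hB : 0 ≤ B) (hf : ∀ v ∈ s, |(f v : ℝ)| ≤ K)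
    (hfib : ∀ k, ((s.filter fun v => f v = k).card : ℝ) ≤ B / √(max 1 |(k : ℝ)|)) :
    (s.card : ℝ) ≤ 6 * B * √K := by
  classical
  have hmaps : ∀ v ∈ s, (f v).natAbs ∈ range (⌊K⌋₊ + 1) := fun v hv => by
    rw [mem_range, Nat.lt_succ_iff]
    exact Nat.le_floor (by rw [Nat.cast_natAbs, Int.cast_abs]; exact hf v hv)
  rw [card_eq_sum_card_fiberwise hmaps]
  push_cast
  have hK1 : 1 ≤ √K := Real.one_le_sqrt.2 hK
  have hfl : √(⌊K⌋₊ : ℝ) ≤ √K := Real.sqrt_le_sqrt (Nat.floor_le (by linarith))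
  calc _ ≤ ∑ k ∈ range (⌊K⌋₊ + 1), 2 * B * (1 / √(max 1 (k : ℝ))) := by
        refine sum_le_sum fun k _ => ?_
        have hsub : (s.filter fun v => (f v).natAbs = k) ⊆
            (s.filter fun v => f v = k) ∪ (s.filter fun v => f v = -k) := fun v hv => by
          rw [mem_filter] at hv
          simp only [mem_union, mem_filter, hv.1, true_and]
          omega
        have h1 : ((s.filter fun v => (f v).natAbs = k).card : ℝ) ≤
            (s.filter fun v => f v = k).card + (s.filter fun v => f v = -k).card := by
          exact_mod_cast (card_le_card hsub).trans (card_union_le _ _)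
        have h2 := hfib k
        have h3 := hfib (-k)
        push_cast at h2 h3
        rw [abs_neg] at h3
        rw [abs_of_nonneg (Nat.cast_nonneg k)] at h2 h3
        calc _ ≤ _ := h1
          _ ≤ B / √(max 1 (k : ℝ)) + B / √(max 1 (k : ℝ)) := add_le_add h2 h3
          _ = _ := by ring
    _ = 2 * B * ∑ k ∈ range (⌊K⌋₊ + 1), 1 / √(max 1 (k : ℝ)) := by rw [mul_sum]
    _ ≤ 2 * B * (1 + 2 * √(⌊K⌋₊ : ℝ)) := by gcongr; exact sum_inv_sqrt_le _
    _ ≤ 2 * B * (3 * √K) := by gcongr; linarith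
    _ = _ := by ring

/-- The Japanese bracket on `ℝ²`, in coordinates. -/
noncomputable def bracket (x y : ℝ) : ℝ := √(1 + x ^ 2 + y ^ 2)

theorem bracket_sq (x y : ℝ) : bracket x y ^ 2 = 1 + x ^ 2 + y ^ 2 :=
  Real.sq_sqrt (by positivity)

theorem bracket_nonneg (x y : ℝ) : 0 ≤ bracket x y := Real.sqrt_nonneg _

theorem bracket_comm (x y : ℝ) : bracket x y = bracket y x := by
  unfold bracket; ring_nf

theorem bracket_le {x y c M : ℝ} (hM : 0 ≤ M) (hx : |x| ≤ c) (hy : |y| ≤ c)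
    (h : 1 + 2 * c ^ 2 ≤ M ^ 2) : bracket x y ≤ M := by
  refine Real.sqrt_le_iff.2 ⟨hM, ?_⟩
  have := sq_le_sq' (abs_le.1 hx).1 (abs_le.1 hx).2
  have := sq_le_sq' (abs_le.1 hy).1 (abs_le.1 hy).2
  linarith

theorem abs_sq_sub_sq_le {u v D M : ℝ} (h : |u - v| ≤ D) (hu : |u| ≤ M) (hv : |v| ≤ M) :
    |u ^ 2 - v ^ 2| ≤ D * (2 * M) := by
  rw [show u ^ 2 - v ^ 2 = (u - v) * (u + v) by ring, abs_mul]
  have : |u + v| ≤ 2 * M := (abs_add_le u v).trans (by linarith)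
  exact mul_le_mul h this (abs_nonneg _) ((abs_nonneg _).trans h)

theorem abs_dot_sub_le {N x y x' y' a b : ℝ} (hN : 1 ≤ N) (hx : |x| ≤ 2 * N) (hy : |y| ≤ 2 * N)
    (hx' : |x'| ≤ 2 * N) (hy' : |y'| ≤ 2 * N) (ha : |a| ≤ 4 * N) (hb : |b| ≤ 4 * N)
    (h0 : |bracket x y - bracket x' y'| ≤ 1)
    (h1 : |bracket (x + a) (y + b) - bracket (x' + a) (y' + b)| ≤ 3) :
    |(x * a + y * b) - (x' * a + y' * b)| ≤ 30 * N := by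
  have hsmall : ∀ {u v : ℝ}, |u| ≤ 2 * N → |v| ≤ 2 * N → |bracket u v| ≤ 3 * N := fun hu hv => by
    rw [abs_of_nonneg (bracket_nonneg _ _)]
    exact bracket_le (by positivity) hu hv (by nlinarith)
  have hlarge : ∀ {u v : ℝ}, |u| ≤ 2 * N → |v| ≤ 2 * N → |bracket (u + a) (v + b)| ≤ 9 * N :=
    fun hu hv => by
      rw [abs_of_nonneg (bracket_nonneg _ _)]
      exact bracket_le (c := 6 * N) (by positivity) ((abs_add_le _ _).trans (by linarith))
        ((abs_add_le _ _).trans (by linarith)) (by nlinarith)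
  have e0 := abs_le.1 (abs_sq_sub_sq_le h0 (hsmall hx hy) (hsmall hx' hy'))
  have e1 := abs_le.1 (abs_sq_sub_sq_le h1 (hlarge hx hy) (hlarge hx' hy'))
  simp only [bracket_sq] at e0 e1
  rw [abs_le]
  constructor <;> nlinarith

theorem abs_sub_le_of_transversal {N R x y x' y' a b : ℝ} (hN : 1 ≤ N) (hR : 0 < R)
    (hRa : R ^ 2 = |a|) (hba : |b| ≤ |a|) (hx : |x| ≤ 2 * N) (hy : |y| ≤ 2 * N)
    (hx' : |x'| ≤ 2 * N) (hy' : |y'| ≤ 2 * N)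
    (h0 : |bracket x y - bracket x' y'| ≤ 1)
    (hdot : |(x * a + y * b) - (x' * a + y' * b)| ≤ |a|)
    (hq : 2 * N * R ≤ |(x * b - y * a) + (x' * b - y' * a)|) :
    |y - y'| ≤ 1 + 10 * R := by
  have hsmall : ∀ {u v : ℝ}, |u| ≤ 2 * N → |v| ≤ 2 * N → |bracket u v| ≤ 3 * N := fun hu hv => by
    rw [abs_of_nonneg (bracket_nonneg _ _)]
    exact bracket_le (by positivity) hu hv (by nlinarith)
  have hpbd : ∀ {u v : ℝ}, |u| ≤ 2 * N → |v| ≤ 2 * N → |u * a + v * b| ≤ 4 * N * |a| :=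
    fun {u v} hu hv => by
      have h1 : |u * a| ≤ 2 * N * |a| := by rw [abs_mul]; gcongr
      have h2 : |v * b| ≤ 2 * N * |a| := by rw [abs_mul]; gcongr
      exact (abs_add_le _ _).trans (by linarith)
  have e0 := abs_sq_sub_sq_le h0 (hsmall hx hy) (hsmall hx' hy')
  have e1 := abs_sq_sub_sq_le hdot (hpbd hx hy) (hpbd hx' hy')
  simp only [bracket_sq] at e0
  set A := |a| with hA
  have hApos : 0 < A := hRa ▸ by positivity
  have haA : a ^ 2 = A ^ 2 := (sq_abs a).symm
  have hbA : b ^ 2 ≤ A ^ 2 := by rw [← sq_abs b]; gcongr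
  set P := x * a + y * b with hP
  set P' := x' * a + y' * b with hP'
  set Q := x * b - y * a with hQ
  set Q' := x' * b - y' * a with hQ'
  have hQsq : |Q ^ 2 - Q' ^ 2| ≤ 20 * N * A ^ 2 := by
    have key : Q ^ 2 - Q' ^ 2 = (1 + x ^ 2 + y ^ 2 - (1 + x' ^ 2 + y' ^ 2)) * (a ^ 2 + b ^ 2)
        - (P ^ 2 - P' ^ 2) := by rw [hQ, hQ', hP, hP']; ring
    rw [key]
    refine (abs_sub _ _).trans ?_
    rw [abs_mul, abs_of_nonneg (show 0 ≤ a ^ 2 + b ^ 2 by positivity)]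
    have : |1 + x ^ 2 + y ^ 2 - (1 + x' ^ 2 + y' ^ 2)| * (a ^ 2 + b ^ 2)
        ≤ 1 * (2 * (3 * N)) * (2 * A ^ 2) :=
      mul_le_mul e0 (by linarith) (by positivity) (by positivity)
    nlinarith
  have hQd : |Q - Q'| ≤ 10 * A * R := by
    rw [show Q ^ 2 - Q' ^ 2 = (Q - Q') * (Q + Q') by ring, abs_mul] at hQsq
    have h2 : |Q - Q'| * (2 * N * R) ≤ 20 * N * A ^ 2 :=
      (mul_le_mul_of_nonneg_left hq (abs_nonneg _)).trans hQsq
    have h3 : 20 * N * A ^ 2 = 10 * A * R * (2 * N * R) := by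
      rw [show 10 * A * R * (2 * N * R) = 20 * N * A * R ^ 2 by ring, hRa]; ring
    rw [h3] at h2
    exact le_of_mul_le_mul_right h2 (by positivity)
  have hy2 : A ^ 2 * |y - y'| ≤ A ^ 2 * (1 + 10 * R) := by
    have key : (a ^ 2 + b ^ 2) * (y - y') = b * (P - P') - a * (Q - Q') := by
      rw [hQ, hQ', hP, hP']; ring
    have h4 : |(a ^ 2 + b ^ 2) * (y - y')| ≤ A * A + A * (10 * A * R) := by
      rw [key]
      refine (abs_sub _ _).trans ?_
      rw [abs_mul, abs_mul]
      gcongr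
    rw [abs_mul, abs_of_nonneg (show 0 ≤ a ^ 2 + b ^ 2 by positivity)] at h4
    have : A ^ 2 * |y - y'| ≤ (a ^ 2 + b ^ 2) * |y - y'| := by
      gcongr; nlinarith [sq_nonneg b]
    linarith
  exact le_of_mul_le_mul_left hy2 (by positivity)

theorem card_strip_le {α : Type*} (s : Finset α) (x y : α → ℤ)
    (hinj : ∀ v ∈ s, ∀ w ∈ s, x v = x w → y v = y w → v = w) {a b : ℤ} (ha0 : a ≠ 0) {N : ℝ}
    (hN : 1 ≤ N) (ha : |(a : ℝ)| ≤ 4 * N) (hx : ∀ v ∈ s, |(x v : ℝ)| ≤ 2 * N)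
    (hq : ∀ v ∈ s, |(x v * b - y v * a : ℝ)| ≤ N * √|(a : ℝ)|) :
    (s.card : ℝ) ≤ 20 * (N ^ 2 / √|(a : ℝ)|) := by
  have hA : (0 : ℝ) < |(a : ℝ)| := by positivity
  set R := √|(a : ℝ)| with hR
  have hRpos : 0 < R := Real.sqrt_pos.2 hA
  have hRA : R ^ 2 = |(a : ℝ)| := Real.sq_sqrt hA.le
  have hRN : R ≤ 2 * N := by nlinarith
  have h1 : (s.card : ℝ) ≤ (4 * N + 1) * (2 * N / R + 1) := by
    refine card_le_of_fibers s x (by positivity) (by positivity)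
      (fun v hv w hw => by linarith [abs_le.1 (hx v hv), abs_le.1 (hx w hw)]) fun k => ?_
    refine card_le_of_injOn _ y (by positivity) (fun v hv w hw => ?_) fun v hv w hw h => ?_
    · rw [Finset.mem_filter] at hv hw
      have h3 := hq v hv.1
      have h4 := hq w hw.1
      rw [hv.2] at h3
      rw [hw.2] at h4
      have h5 : |(y v - y w : ℝ) * a| ≤ 2 * N * R := by
        rw [show (y v - y w : ℝ) * a = (k * b - y w * a) - (k * b - y v * a) by ring]
        exact (abs_sub _ _).trans (by linarith)
      rw [abs_mul, ← hRA] at h5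
      rw [le_div_iff₀ hRpos]
      have : |(y v - y w : ℝ)| * R ≤ 2 * N :=
        le_of_mul_le_mul_right (by linarith) hRpos
      exact (mul_le_mul_of_nonneg_right (le_abs_self _) hRpos.le).trans this
    · rw [Finset.mem_filter] at hv hw
      exact hinj v hv.1 w hw.1 (hv.2.trans hw.2.symm) h
  have h2 : 1 ≤ 2 * N / R := by rwa [one_le_div hRpos]
  calc (s.card : ℝ) ≤ _ := h1
    _ ≤ (5 * N) * (2 * N / R + 2 * N / R) := by gcongr; linarith
    _ = _ := by ring

theorem card_transversal_le {α : Type*} (s : Finset α) (x y : α → ℤ)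
    (hinj : ∀ v ∈ s, ∀ w ∈ s, x v = x w → y v = y w → v = w) {a b : ℤ} (ha0 : a ≠ 0)
    (hba : |(b : ℝ)| ≤ |(a : ℝ)|) {N : ℝ} (hN : 1 ≤ N) (ha : |(a : ℝ)| ≤ 4 * N)
    (hx : ∀ v ∈ s, |(x v : ℝ)| ≤ 2 * N) (hy : ∀ v ∈ s, |(y v : ℝ)| ≤ 2 * N)
    (hJ : ∀ v ∈ s, ∀ w ∈ s, |bracket (x v) (y v) - bracket (x w) (y w)| ≤ 1 →
      |bracket (x v + a) (y v + b) - bracket (x w + a) (y w + b)| ≤ 3)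
    (hq : ∀ v ∈ s, ∀ w ∈ s,
      2 * N * √|(a : ℝ)| ≤ |(x v * b - y v * a : ℝ) + (x w * b - y w * a)|) :
    (s.card : ℝ) ≤ 3648 * (N ^ 2 / √|(a : ℝ)|) := by
  have hA : (0 : ℝ) < |(a : ℝ)| := by positivity
  have hA1 : (1 : ℝ) ≤ |(a : ℝ)| := by exact_mod_cast Int.one_le_abs ha0
  set R := √|(a : ℝ)| with hR
  have hRpos : 0 < R := Real.sqrt_pos.2 hA
  have hR1 : 1 ≤ R := Real.one_le_sqrt.2 hA1
  have hRA : R ^ 2 = |(a : ℝ)| := Real.sq_sqrt hA.le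
  have hb3 : ∀ v ∈ s, bracket (x v) (y v) ≤ 3 * N := fun v hv =>
    bracket_le (by positivity) (hx v hv) (hy v hv) (by nlinarith)
  have h1 : (s.card : ℝ) ≤
      (3 * N + 1) * ((30 * N / |(a : ℝ)| + 1 + 1) * ((1 + 10 * R + 1) * (1 + 1))) := by
    refine card_le_of_fibers s (fun v => ⌊bracket (x v) (y v)⌋) (by positivity) (by positivity)
      (fun v hv w hw => ?_) fun j => ?_
    · have := Int.floor_le (bracket (x v) (y v))
      have : (0 : ℝ) ≤ ⌊bracket (x w) (y w)⌋ := by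
        exact_mod_cast Int.floor_nonneg.2 (bracket_nonneg _ _)
      linarith [hb3 v hv]
    have hnear : ∀ v ∈ s.filter (fun v => ⌊bracket (x v) (y v)⌋ = j),
        ∀ w ∈ s.filter (fun v => ⌊bracket (x v) (y v)⌋ = j),
        |bracket (x v) (y v) - bracket (x w) (y w)| ≤ 1 := fun v hv w hw => by
      rw [Finset.mem_filter] at hv hw
      exact (Int.abs_sub_lt_one_of_floor_eq_floor (hv.2.trans hw.2.symm)).le
    refine card_le_of_fibers _ (fun v => ⌊(x v * a + y v * b : ℝ) / |(a : ℝ)|⌋) (by positivity)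
      (by positivity) (fun v hv w hw => ?_) fun k => ?_
    · have hvw := hnear v hv w hw
      rw [Finset.mem_filter] at hv hw
      have h3 := abs_dot_sub_le hN (hx v hv.1) (hy v hv.1) (hx w hw.1) (hy w hw.1) ha
        (hba.trans ha) hvw (hJ v hv.1 w hw.1 hvw)
      have h4 := Int.floor_le ((x v * a + y v * b : ℝ) / |(a : ℝ)|)
      have h5 := Int.lt_floor_add_one ((x w * a + y w * b : ℝ) / |(a : ℝ)|)
      have h6 : (x v * a + y v * b : ℝ) / |(a : ℝ)| - (x w * a + y w * b : ℝ) / |(a : ℝ)| ≤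
          30 * N / |(a : ℝ)| := by
        rw [← sub_div]
        gcongr
        exact (le_abs_self _).trans h3
      linarith
    have hdot : ∀ v ∈ (s.filter (fun v => ⌊bracket (x v) (y v)⌋ = j)).filter
          (fun v => ⌊(x v * a + y v * b : ℝ) / |(a : ℝ)|⌋ = k),
        ∀ w ∈ (s.filter (fun v => ⌊bracket (x v) (y v)⌋ = j)).filter
          (fun v => ⌊(x v * a + y v * b : ℝ) / |(a : ℝ)|⌋ = k),
        |(x v * a + y v * b : ℝ) - (x w * a + y w * b)| ≤ |(a : ℝ)| := fun v hv w hw => by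
      rw [Finset.mem_filter] at hv hw
      have := (Int.abs_sub_lt_one_of_floor_eq_floor (hv.2.trans hw.2.symm)).le
      rwa [← sub_div, abs_div, abs_abs, div_le_one hA] at this
    refine card_le_of_fibers _ y (by positivity) (by positivity) (fun v hv w hw => ?_) fun l => ?_
    · have hd := hdot v hv w hw
      rw [Finset.mem_filter] at hv hw
      have hvw := hnear v hv.1 w hw.1
      have hv := (Finset.mem_filter.1 hv.1).1
      have hw := (Finset.mem_filter.1 hw.1).1
      exact (le_abs_self _).trans (abs_sub_le_of_transversal hN hRpos hRA hba (hx v hv) (hy v hv)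
        (hx w hw) (hy w hw) hvw hd (hq v hv w hw))
    refine card_le_of_injOn _ x zero_le_one (fun v hv w hw => ?_) fun v hv w hw h => ?_
    · rw [Finset.mem_filter] at hv hw
      have hd := hdot v hv.1 w hw.1
      rw [hv.2, hw.2, add_sub_add_right_eq_sub, ← sub_mul, abs_mul] at hd
      exact (le_abs_self _).trans (le_of_mul_le_mul_right (by linarith) hA)
    · simp only [Finset.mem_filter] at hv hw
      exact hinj v hv.1.1.1 w hw.1.1.1 h (hv.2.trans hw.2.symm)
  have h2 : 1 ≤ 4 * N / |(a : ℝ)| := by rwa [one_le_div hA]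
  calc (s.card : ℝ) ≤ _ := h1
    _ ≤ (4 * N) * ((30 * N / |(a : ℝ)| + 4 * N / |(a : ℝ)| + 4 * N / |(a : ℝ)|)
          * ((R + 10 * R + R) * (1 + 1))) := by gcongr; linarith
    _ = 3648 * (N ^ 2 * R / R ^ 2) := by rw [hRA]; ring
    _ = _ := by rw [pow_two R, mul_div_mul_right _ _ hRpos.ne']

theorem card_le_of_dominant {α : Type*} (s : Finset α) (x y : α → ℤ)
    (hinj : ∀ v ∈ s, ∀ w ∈ s, x v = x w → y v = y w → v = w) {a b : ℤ} (ha0 : a ≠ 0)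
    (hba : |(b : ℝ)| ≤ |(a : ℝ)|) {N : ℝ} (hN : 1 ≤ N) (ha : |(a : ℝ)| ≤ 4 * N)
    (hx : ∀ v ∈ s, |(x v : ℝ)| ≤ 2 * N) (hy : ∀ v ∈ s, |(y v : ℝ)| ≤ 2 * N)
    (hJ : ∀ v ∈ s, ∀ w ∈ s, |bracket (x v) (y v) - bracket (x w) (y w)| ≤ 1 →
      |bracket (x v + a) (y v + b) - bracket (x w + a) (y w + b)| ≤ 3) :
    (s.card : ℝ) ≤ 7316 * (N ^ 2 / √|(a : ℝ)|) := by
  classical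
  let q : α → ℝ := fun v => x v * b - y v * a
  set T := N * √|(a : ℝ)| with hT
  have hsub : s ⊆ s.filter (fun v => |q v| ≤ T) ∪
      (s.filter (fun v => T ≤ q v) ∪ s.filter (fun v => q v ≤ -T)) := fun v hv => by
    simp only [Finset.mem_union, Finset.mem_filter, hv, true_and, abs_le]
    grind
  have hcard : (s.card : ℝ) ≤ (s.filter fun v => |q v| ≤ T).card +
      ((s.filter fun v => T ≤ q v).card + (s.filter fun v => q v ≤ -T).card) := by
    exact_mod_cast (Finset.card_le_card hsub).trans ((Finset.card_union_le _ _).trans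
      (Nat.add_le_add_left (Finset.card_union_le _ _) _))
  have h0 := card_strip_le (s.filter fun v => |q v| ≤ T) x y (b := b)
    (fun v hv w hw => hinj v (Finset.mem_filter.1 hv).1 w (Finset.mem_filter.1 hw).1) ha0 hN ha
    (fun v hv => hx v (Finset.mem_filter.1 hv).1) fun v hv => (Finset.mem_filter.1 hv).2
  have h1 : ∀ p : α → Prop, (∀ v w, p v → p w → 2 * T ≤ |q v + q w|) →
      ((s.filter p).card : ℝ) ≤ 3648 * (N ^ 2 / √|(a : ℝ)|) := fun p hp =>
    card_transversal_le _ x y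
      (fun v hv w hw => hinj v (Finset.mem_filter.1 hv).1 w (Finset.mem_filter.1 hw).1) ha0 hba hN
      ha (fun v hv => hx v (Finset.mem_filter.1 hv).1) (fun v hv => hy v (Finset.mem_filter.1 hv).1)
      (fun v hv w hw => hJ v (Finset.mem_filter.1 hv).1 w (Finset.mem_filter.1 hw).1)
      fun v hv w hw => by
        rw [mul_assoc]
        exact hp v w (Finset.mem_filter.1 hv).2 (Finset.mem_filter.1 hw).2
  have h2 := h1 (fun v => T ≤ q v) fun v w hv hw => by
    linarith [le_abs_self (q v + q w)]
  have h3 := h1 (fun v => q v ≤ -T) fun v w hv hw => by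
    linarith [neg_le_abs (q v + q w)]
  linarith

/-- Counting lattice points in the intersection of unit neighbourhoods of circles centred at `0`
and at `-(a, b)`, summed over all radii of the first circle. -/
theorem card_two_brackets_le {α : Type*} (s : Finset α) (x y : α → ℤ)
    (hinj : ∀ v ∈ s, ∀ w ∈ s, x v = x w → y v = y w → v = w) {a b : ℤ} {N : ℝ} (hN : 1 ≤ N)
    (ha : |(a : ℝ)| ≤ 4 * N) (hb : |(b : ℝ)| ≤ 4 * N)
    (hx : ∀ v ∈ s, |(x v : ℝ)| ≤ 2 * N) (hy : ∀ v ∈ s, |(y v : ℝ)| ≤ 2 * N)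
    (hJ : ∀ v ∈ s, ∀ w ∈ s, |bracket (x v) (y v) - bracket (x w) (y w)| ≤ 1 →
      |bracket (x v + a) (y v + b) - bracket (x w + a) (y w + b)| ≤ 3) :
    (s.card : ℝ) ≤ 7316 * N ^ 2 / √(max 1 |(a : ℝ)|) := by
  rw [mul_div_assoc]
  by_cases h0 : a = 0 ∧ b = 0
  · have h1 : (s.card : ℝ) ≤ (4 * N + 1) * (4 * N + 1) := by
      refine card_le_of_fibers s x (by positivity) (by positivity)
        (fun v hv w hw => by linarith [abs_le.1 (hx v hv), abs_le.1 (hx w hw)]) fun k => ?_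
      refine card_le_of_injOn _ y (by positivity) (fun v hv w hw => ?_) fun v hv w hw h => ?_
      · rw [Finset.mem_filter] at hv hw
        linarith [abs_le.1 (hy v hv.1), abs_le.1 (hy w hw.1)]
      · rw [Finset.mem_filter] at hv hw
        exact hinj v hv.1 w hw.1 (hv.2.trans hw.2.symm) h
    rw [h0.1]
    simp only [Int.cast_zero, abs_zero, zero_le_one, max_eq_left, Real.sqrt_one, div_one]
    nlinarith
  rcases le_total |(b : ℝ)| |(a : ℝ)| with hba | hab
  · have ha0 : a ≠ 0 := fun h => h0 ⟨h, by simpa [h] using hba⟩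
    have hA1 : (1 : ℝ) ≤ |(a : ℝ)| := by exact_mod_cast Int.one_le_abs ha0
    rw [max_eq_right hA1]
    exact card_le_of_dominant s x y hinj ha0 hba hN ha hx hy hJ
  · have hb0 : b ≠ 0 := fun h => h0 ⟨by simpa [h] using hab, h⟩
    have hB1 : (1 : ℝ) ≤ |(b : ℝ)| := by exact_mod_cast Int.one_le_abs hb0
    refine (card_le_of_dominant s y x (fun v hv w hw h h' => hinj v hv w hw h' h) hb0 hab hN hb
      hy hx fun v hv w hw => ?_).trans ?_
    · simpa only [bracket_comm] using hJ v hv w hw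
    · gcongr
      exact max_le hB1 hab

theorem card_triples_le {α : Type*} (s : Finset α) (p q r : α → Fin 2 → ℤ)
    (hinj : ∀ v ∈ s, ∀ w ∈ s, p v = p w → q v = q w → r v = r w → v = w) {N₁ N₂ N₃ : ℝ}
    (h3 : 1 ≤ N₃) (h32 : N₃ ≤ N₂) (h21 : N₂ ≤ N₁)
    (hp : ∀ v ∈ s, ∀ i, |(p v i : ℝ)| ≤ 2 * N₁) (hq : ∀ v ∈ s, ∀ i, |(q v i : ℝ)| ≤ 2 * N₂)
    (hr : ∀ v ∈ s, ∀ i, |(r v i : ℝ)| ≤ 2 * N₃)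
    (hJ : ∀ v ∈ s, ∀ w ∈ s, q v = q w → r v = r w → |jb (p v) - jb (p w)| ≤ 1 →
      |jb (p v + q v + r v) - jb (p w + q w + r w)| ≤ 3) :
    (s.card : ℝ) ≤ 19753200 * (N₁ * N₂ * N₃) ^ 2 / √N₂ := by
  have h2 : 1 ≤ N₂ := h3.trans h32
  have h1 : 1 ≤ N₁ := h2.trans h21
  have hqr : ∀ v ∈ s, ∀ i, |((q v i + r v i : ℤ) : ℝ)| ≤ 4 * N₂ := fun v hv i => by
    push_cast
    exact (abs_add_le _ _).trans (by linarith [hq v hv i, hr v hv i])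
  have hmain : (s.card : ℝ) ≤ (4 * N₃ + 1) * ((4 * N₃ + 1) *
      ((8 * N₂ + 1) * (6 * (7316 * N₁ ^ 2) * √(4 * N₂)))) := by
    refine card_le_of_fibers s (fun v => r v 0) (by positivity) (by positivity)
      (fun v hv w hw => by linarith [abs_le.1 (hr v hv 0), abs_le.1 (hr w hw 0)]) fun i => ?_
    refine card_le_of_fibers _ (fun v => r v 1) (by positivity) (by positivity)
      (fun v hv w hw => ?_) fun j => ?_
    · rw [Finset.mem_filter] at hv hw
      linarith [abs_le.1 (hr v hv.1 1), abs_le.1 (hr w hw.1 1)]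
    refine card_le_of_fibers _ (fun v => q v 1 + r v 1) (by positivity) (by positivity)
      (fun v hv w hw => ?_) fun l => ?_
    · simp only [Finset.mem_filter] at hv hw
      linarith [abs_le.1 (hqr v hv.1.1 1), abs_le.1 (hqr w hw.1.1 1)]
    refine card_le_of_weighted_fibers _ (fun v => q v 0 + r v 0) (by linarith) (by positivity)
      (fun v hv => ?_) fun k => ?_
    · simp only [Finset.mem_filter] at hv
      exact hqr v hv.1.1.1 0
    set t := ((((s.filter fun v => r v 0 = i).filter fun v => r v 1 = j).filter
      fun v => q v 1 + r v 1 = l).filter fun v => q v 0 + r v 0 = k) with ht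
    have hmem : ∀ v ∈ t, v ∈ s ∧ r v = ![i, j] ∧ q v = ![k - i, l - j] := fun v hv => by
      simp only [ht, Finset.mem_filter] at hv
      obtain ⟨⟨⟨⟨hv, hi⟩, hj⟩, hl⟩, hk⟩ := hv
      refine ⟨hv, ?_, ?_⟩ <;> ext n <;> fin_cases n <;> simp <;> omega
    rcases t.eq_empty_or_nonempty with he | ⟨v₀, hv₀⟩
    · rw [he]; simpa using by positivity
    obtain ⟨hs₀, hr₀, hq₀⟩ := hmem v₀ hv₀
    have hk := hqr v₀ hs₀ 0
    have hl := hqr v₀ hs₀ 1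
    simp only [hr₀, hq₀, Matrix.cons_val_zero, Matrix.cons_val_one, sub_add_cancel] at hk hl
    refine card_two_brackets_le t (fun v => p v 0) (fun v => p v 1) (fun v hv w hw h h' => ?_)
      (b := l) h1 (hk.trans (by linarith)) (hl.trans (by linarith))
      (fun v hv => hp v (hmem v hv).1 0) (fun v hv => hp v (hmem v hv).1 1) fun v hv w hw h => ?_
    · obtain ⟨hsv, hrv, hqv⟩ := hmem v hv
      obtain ⟨hsw, hrw, hqw⟩ := hmem w hw
      exact hinj v hsv w hsw (by ext n; fin_cases n <;> assumption) (hqv.trans hqw.symm)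
        (hrv.trans hrw.symm)
    · obtain ⟨hsv, hrv, hqv⟩ := hmem v hv
      obtain ⟨hsw, hrw, hqw⟩ := hmem w hw
      have hsum : ∀ u ∈ t, jb (p u + q u + r u) = bracket (p u 0 + k) (p u 1 + l) := fun u hu => by
        obtain ⟨-, hru, hqu⟩ := hmem u hu
        rw [jb, bracket, hru, hqu]
        simp only [Pi.add_apply, Matrix.cons_val_zero, Matrix.cons_val_one]
        push_cast
        ring_nf
      rw [← hsum v hv, ← hsum w hw]
      exact hJ v hsv w hsw (hqv.trans hqw.symm) (hrv.trans hrw.symm) h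
  have hpos : 0 < √N₂ := Real.sqrt_pos.2 (by linarith)
  have h4 : √(4 * N₂) = 2 * √N₂ := by
    rw [Real.sqrt_mul (by norm_num), show (4 : ℝ) = 2 ^ 2 by norm_num,
      Real.sqrt_sq (by norm_num)]
  rw [h4] at hmain
  rw [le_div_iff₀ hpos]
  calc (s.card : ℝ) * √N₂ ≤ (5 * N₃) * ((5 * N₃) * ((9 * N₂) *
        (6 * (7316 * N₁ ^ 2) * (2 * √N₂)))) * √N₂ := by
        gcongr
        refine hmain.trans ?_
        gcongr <;> linarith
    _ = 19753200 * (N₁ ^ 2 * N₂ * N₃ ^ 2) * √N₂ ^ 2 := by ring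
    _ = _ := by rw [Real.sq_sqrt (by linarith)]; ring

theorem abs_coord_le_of_ann {N : ℝ} {x : Fin 2 → ℤ} (h : ann N x) (i : Fin 2) :
    |(x i : ℝ)| ≤ 2 * N := by
  refine (Real.abs_le_sqrt ?_).trans h.2
  fin_cases i
  · simpa using sq_nonneg (x 1 : ℝ)
  · simpa using sq_nonneg (x 0 : ℝ)

/-- If two signed sums of brackets differ by at most `2` and one bracket varies by at most `1`,
then the other varies by at most `3`. -/
theorem abs_sub_le_three {σ τ A A' B B' c m : ℝ} (hσ : σ = -1 ∨ σ = 1) (hτ : τ = -1 ∨ τ = 1)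
    (h : |σ * A + τ * B + c - m| ≤ 1) (h' : |σ * A' + τ * B' + c - m| ≤ 1)
    (hB : |B - B'| ≤ 1) : |A - A'| ≤ 3 := by
  rw [abs_le] at *
  rcases hσ with rfl | rfl <;> rcases hτ with rfl | rfl <;> constructor <;> linarith

theorem cubicSet_finite (σ σ₁ σ₂ σ₃ N₁ N₂ N₃ : ℝ) (m : ℤ) :
    (cubicSet σ σ₁ σ₂ σ₃ N₁ N₂ N₃ m).Finite := by
  set B : ℤ := ⌊2 * max N₁ (max N₂ N₃)⌋
  have hB : ∀ {N : ℝ} {x : Fin 2 → ℤ}, ann N x → N ≤ max N₁ (max N₂ N₃) →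
      ∀ i, -B ≤ x i ∧ x i ≤ B := fun {N x} h hN i => by
    rw [← abs_le]
    refine Int.le_floor.2 ?_
    push_cast
    exact (abs_coord_le_of_ann h i).trans (by linarith)
  refine (Set.finite_Icc (fun (_ : Fin 3) (_ : Fin 2) => -B) (fun _ _ => B)).subset ?_
  rintro v ⟨h₀, h₁, h₂, -⟩
  have key : ∀ i j, -B ≤ v i j ∧ v i j ≤ B := fun i j => by
    fin_cases i
    · exact hB h₀ (by simp) j
    · exact hB h₁ (by simp) j
    · exact hB h₂ (by simp) j
  exact ⟨fun i j => (key i j).1, fun i j => (key i j).2⟩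

/-- The counting estimate for `cubicSet` when the coordinates, listed in the order `a, b, c`, have
decreasing sizes `N a ≥ N b ≥ N c`. -/
theorem ncard_cubicSet_le {σ : ℝ} {τ : Fin 3 → ℝ} {N : Fin 3 → ℝ} {m : ℤ} (hσ : σ = -1 ∨ σ = 1)
    (hτ : ∀ i, τ i = -1 ∨ τ i = 1) (e : Equiv.Perm (Fin 3)) (h3 : 1 ≤ N (e 2))
    (h32 : N (e 2) ≤ N (e 1)) (h21 : N (e 1) ≤ N (e 0)) :
    ((cubicSet σ (τ 0) (τ 1) (τ 2) (N 0) (N 1) (N 2) m).ncard : ℝ) ≤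
      19753200 * (N 0 * N 1 * N 2) ^ 2 / √(N (e 1)) := by
  have hfin := cubicSet_finite σ (τ 0) (τ 1) (τ 2) (N 0) (N 1) (N 2) m
  rw [Set.ncard_eq_toFinset_card _ hfin]
  have hann : ∀ v ∈ hfin.toFinset, ∀ i, ann (N i) (v i) := fun v hv i => by
    obtain ⟨h₀, h₁, h₂, -⟩ := hfin.mem_toFinset.1 hv
    fin_cases i <;> assumption
  have hsum : ∀ {M : Type} [AddCommMonoid M] (f : Fin 3 → M),
      f 0 + f 1 + f 2 = f (e 0) + f (e 1) + f (e 2) := fun f => by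
    rw [← Fin.sum_univ_three, ← Fin.sum_univ_three (fun i => f (e i)), Equiv.sum_comp e]
  have hprod : N 0 * N 1 * N 2 = N (e 0) * N (e 1) * N (e 2) := by
    rw [← Fin.prod_univ_three, ← Fin.prod_univ_three (fun i => N (e i)), Equiv.prod_comp e]
  have hphase : ∀ v ∈ hfin.toFinset,
      |σ * jb (v (e 0) + v (e 1) + v (e 2)) + τ (e 0) * jb (v (e 0)) +
        (τ (e 1) * jb (v (e 1)) + τ (e 2) * jb (v (e 2))) - m| ≤ 1 := fun v hv => by
    have h := (hfin.mem_toFinset.1 hv).2.2.2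
    rw [phase, hsum v] at h
    convert h using 2
    linarith [hsum fun i => τ i * jb (v i)]
  rw [hprod]
  refine card_triples_le _ (fun v => v (e 0)) (fun v => v (e 1)) (fun v => v (e 2))
    (fun v _ w _ h₀ h₁ h₂ => ?_) h3 h32 h21
    (fun v hv => abs_coord_le_of_ann (hann v hv _)) (fun v hv => abs_coord_le_of_ann (hann v hv _))
    (fun v hv => abs_coord_le_of_ann (hann v hv _)) fun v hv w hw h₁ h₂ h => ?_
  · funext i
    obtain ⟨j, rfl⟩ := e.surjective i
    fin_cases j <;> assumption
  · have hw' := hphase w hw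
    nth_rw 2 [← h₁, ← h₂] at hw'
    exact abs_sub_le_three hσ (hτ _) (hphase v hv) hw' h

theorem exists_perm_antitone (N : Fin 3 → ℝ) :
    ∃ e : Equiv.Perm (Fin 3), N (e 2) ≤ N (e 1) ∧ N (e 1) ≤ N (e 0) := by
  have h := Tuple.monotone_sort (fun i => -N i)
  exact ⟨Tuple.sort fun i => -N i, neg_le_neg_iff.1 (h (by decide : (1 : Fin 3) ≤ 2)),
    neg_le_neg_iff.1 (h (by decide : (0 : Fin 3) ≤ 1))⟩

theorem med3_eq {N : Fin 3 → ℝ} {e : Equiv.Perm (Fin 3)} (h32 : N (e 2) ≤ N (e 1))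
    (h21 : N (e 1) ≤ N (e 0)) : med3 (N 0) (N 1) (N 2) = N (e 1) := by
  have h01 : e 0 ≠ e 1 := e.injective.ne (by decide)
  have h02 : e 0 ≠ e 2 := e.injective.ne (by decide)
  have h12 : e 1 ≠ e 2 := e.injective.ne (by decide)
  unfold med3
  generalize e 0 = i, e 1 = j, e 2 = k at *
  fin_cases i <;> fin_cases j <;> fin_cases k <;> simp_all

/-- cubic counting estimate (i): there is a universal `C > 0` such that for all
signs, dyadic `N₁, N₂, N₃` and every `m ∈ ℤ`,
`#{(n₁,n₂,n₃) : |n_j| ∼ N_j, |φ − m| ≤ 1} ≤ C (N₁N₂N₃)² / med(N₁,N₂,N₃)^{1/2}`. -/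
theorem cubic_counting_i :
    ∃ C : ℝ, 0 < C ∧
      ∀ (σ σ₁ σ₂ σ₃ : ℝ), (σ = -1 ∨ σ = 1) → (σ₁ = -1 ∨ σ₁ = 1) →
        (σ₂ = -1 ∨ σ₂ = 1) → (σ₃ = -1 ∨ σ₃ = 1) →
        ∀ (k₁ k₂ k₃ : ℕ) (m : ℤ),
          (cubicSet σ σ₁ σ₂ σ₃ ((2:ℝ)^k₁) ((2:ℝ)^k₂) ((2:ℝ)^k₃) m).Finite ∧
          ((cubicSet σ σ₁ σ₂ σ₃ ((2:ℝ)^k₁) ((2:ℝ)^k₂) ((2:ℝ)^k₃) m).ncard : ℝ) ≤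
            C * ((2:ℝ)^k₁ * (2:ℝ)^k₂ * (2:ℝ)^k₃) ^ 2 /
              Real.sqrt (med3 ((2:ℝ)^k₁) ((2:ℝ)^k₂) ((2:ℝ)^k₃)) := by
  refine ⟨19753200, by norm_num, fun σ σ₁ σ₂ σ₃ hσ h₁ h₂ h₃ k₁ k₂ k₃ m =>
    ⟨cubicSet_finite _ _ _ _ _ _ _ _, ?_⟩⟩
  have hτ : ∀ i, (![σ₁, σ₂, σ₃] : Fin 3 → ℝ) i = -1 ∨ (![σ₁, σ₂, σ₃] : Fin 3 → ℝ) i = 1 :=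
    fun i => by fin_cases i <;> assumption
  have hN : ∀ i, 1 ≤ (![2 ^ k₁, 2 ^ k₂, 2 ^ k₃] : Fin 3 → ℝ) i := fun i => by
    fin_cases i <;> exact one_le_pow₀ one_le_two
  obtain ⟨e, h32, h21⟩ := exists_perm_antitone ![2 ^ k₁, 2 ^ k₂, 2 ^ k₃]
  have h := ncard_cubicSet_le (m := m) hσ hτ e (hN _) h32 h21
  rw [← med3_eq h32 h21] at h
  exact h
end
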